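/- arXiv:math/0703867 — 8 statements merged into one kernel-verified Lean document; each statement's English description precedes it below -/
import Mathlib

section
/- Let A be a finite set with k ≥ 2 elements and let B_0 ⊂ B_1 ⊂ ⋯ ⊂ B_k be the chain of all clones on A containing all unary operations. For each 0 ≤ i ≤ k, there exists an infinite sequence (f_n) of operations on A such that f_{n+1} is a proper B_i-subfunction of f_n for every n, if and only if 2 ≤ i ≤ k−2. -/
namespace PaperSubfn

/-- A finitary operation on `A`: an arity `n` together with a map `(Fin n → A) → A`. -/
abbrev Op (A : Type*) := Σ n : ℕ, (Fin n → A) → A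

variable {A : Type*}

/-- `f` is a `C`-subfunction of `g`: `f = g(h₁, …, h_m)` with all `h_i ∈ C`. -/
def Subfn (C : Set (Op A)) (f g : Op A) : Prop :=
  ∃ h : Fin g.1 → ((Fin f.1 → A) → A),
    (∀ i, (⟨f.1, h i⟩ : Op A) ∈ C) ∧ ∀ a, f.2 a = g.2 fun i => h i a

/-- `f` and `g` are `C`-equivalent. -/
def EquivC (C : Set (Op A)) (f g : Op A) : Prop :=
  Subfn C f g ∧ Subfn C g f

/-- `f` is a proper `C`-subfunction of `g`. -/
def ProperSubfn (C : Set (Op A)) (f g : Op A) : Prop :=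
  Subfn C f g ∧ ¬ Subfn C g f

/-- `f` and `g` are `C`-incomparable. -/
def Incomp (C : Set (Op A)) (f g : Op A) : Prop :=
  ¬ Subfn C f g ∧ ¬ Subfn C g f

/-- The `n`-ary `i`-th projection. -/
def proj (A : Type*) (n : ℕ) (i : Fin n) : Op A := ⟨n, fun a => a i⟩

/-- `C` is closed under functional composition. -/
def ClosedComp (C : Set (Op A)) : Prop :=
  ∀ (n m : ℕ) (f : (Fin n → A) → A) (g : Fin n → (Fin m → A) → A),
    (⟨n, f⟩ : Op A) ∈ C → (∀ i, (⟨m, g i⟩ : Op A) ∈ C) →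
      (⟨m, fun a => f fun i => g i a⟩ : Op A) ∈ C

/-- A clone: contains all projections and is closed under composition. -/
def IsClone (C : Set (Op A)) : Prop :=
  (∀ n i, proj A n i ∈ C) ∧ ClosedComp C

/-- The clone generated by a set of operations. -/
def cloneGen (S : Set (Op A)) : Set (Op A) :=
  ⋂₀ {C : Set (Op A) | IsClone C ∧ S ⊆ C}

/-- The `i`-th variable is essential in `f`. -/
def essAt {n : ℕ} (f : (Fin n → A) → A) (i : Fin n) : Prop :=
  ∃ a b : Fin n → A, (∀ j, j ≠ i → a j = b j) ∧ f a ≠ f b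

/-- The set of essential variables. -/
def essSet {n : ℕ} (f : (Fin n → A) → A) : Set (Fin n) := {i | essAt f i}

/-- The essential arity of an operation. -/
noncomputable def essArity (f : Op A) : ℕ := (essSet f.2).ncard

/-- `f` is essentially at most unary. -/
def EssUnary (f : Op A) : Prop := (essSet f.2).Subsingleton

/-- The range of an operation. -/
def rng (f : Op A) : Set A := Set.range f.2

/-- Quasilinear operations: `f = g(h₁(x₁) ⊕ ⋯ ⊕ h_n(x_n))`. -/
def Quasilinear (f : Op A) : Prop :=
  ∃ (h : Fin f.1 → A → ZMod 2) (g : ZMod 2 → A),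
    ∀ a, f.2 a = g (∑ i, h i (a i))

/-- The class of all unary operations. -/
def unaries (A : Type*) : Set (Op A) := {f : Op A | f.1 = 1}

/-- The chain of clones `B_0 ⊂ B_1 ⊂ ⋯ ⊂ B_k` containing all unary operations. -/
def B (A : Type*) : ℕ → Set (Op A)
  | 0 => cloneGen (unaries A)
  | 1 => {f : Op A | EssUnary f ∨ Quasilinear f}
  | (i + 2) => {f : Op A | EssUnary f ∨ (rng f).ncard ≤ i + 2}

theorem agree_ess_aux {n : ℕ} (f : (Fin n → A) → A) (s : Finset (Fin n)) :
    (∀ i ∈ s, ¬ essAt f i) → ∀ x y : Fin n → A, (∀ i, i ∉ s → x i = y i) → f x = f y := by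
  classical
  induction s using Finset.induction_on with
  | empty => intro _ x y h; congr 1; funext i; exact h i (by simp)
  | insert a s ha ih =>
    intro hs x y h
    have h1 : f x = f (Function.update x a (y a)) := by
      by_contra hne
      exact hs a (by simp) ⟨x, Function.update x a (y a),
        fun j hj => by simp [Function.update_of_ne hj], hne⟩
    rw [h1]
    apply ih (fun i hi => hs i (by simp [hi]))
    intro i hi
    by_cases hia : i = a
    · subst hia; simp
    · rw [Function.update_of_ne hia]; exact h i (by simp [hia, hi])

theorem agree_ess {n : ℕ} (f : (Fin n → A) → A) (x y : Fin n → A)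
    (h : ∀ i, essAt f i → x i = y i) : f x = f y := by
  classical
  apply agree_ess_aux f (Finset.univ.filter fun i => ¬ essAt f i)
  · intro i hi; simpa using hi
  · intro i hi; apply h; simpa using hi

theorem essUnary_cases {n : ℕ} (f : (Fin n → A) → A) (hf : EssUnary ⟨n, f⟩) :
    (∃ c, ∀ x, f x = c) ∨ ∃ (l : Fin n) (u : A → A), ∀ x, f x = u (x l) := by
  by_cases h : ∃ l, essAt f l
  · obtain ⟨l, hl⟩ := h
    refine Or.inr ⟨l, fun v => f fun _ => v, fun x => agree_ess f _ _ ?_⟩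
    intro i hi
    have : i = l := hf hi hl
    rw [this]
  · push Not at h
    by_cases hA : Nonempty (Fin n → A)
    · obtain ⟨x0⟩ := hA
      exact Or.inl ⟨f x0, fun x => agree_ess f _ _ fun i hi => absurd hi (h i)⟩
    · rcases n with _ | n
      · exact absurd ⟨fun i => i.elim0⟩ hA
      · exact Or.inr ⟨0, id, fun x => absurd ⟨x⟩ hA⟩

theorem essUnary_const (n : ℕ) (c : A) : EssUnary (⟨n, fun _ => c⟩ : Op A) := by
  rintro i ⟨a, b, _, h⟩; exact absurd rfl h

theorem essUnary_unary {n : ℕ} (l : Fin n) (u : A → A) :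
    EssUnary (⟨n, fun x => u (x l)⟩ : Op A) := by
  have key : ∀ i, essAt (fun x : Fin n → A => u (x l)) i → i = l := by
    rintro i ⟨a, b, h, hne⟩
    by_contra hil
    exact hne (by simp [h l (fun e => hil e.symm)])
  intro i hi j hj
  rw [key i hi, key j hj]

theorem essUnary_of_const {n : ℕ} {f : (Fin n → A) → A} {c : A} (h : ∀ x, f x = c) :
    EssUnary (⟨n, f⟩ : Op A) := by
  have : f = fun _ => c := funext h
  subst this; exact essUnary_const n c

theorem essUnary_of_unary {n : ℕ} {f : (Fin n → A) → A} {l : Fin n} {u : A → A}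
    (h : ∀ x, f x = u (x l)) : EssUnary (⟨n, f⟩ : Op A) := by
  have : f = fun x => u (x l) := funext h
  subst this; exact essUnary_unary l u

theorem Subfn.trans' {C : Set (Op A)} (hC : IsClone C) {f g h : Op A} (h1 : Subfn C f g)
    (h2 : Subfn C g h) : Subfn C f h := by
  obtain ⟨u, hu, hfu⟩ := h1
  obtain ⟨v, hv, hgv⟩ := h2
  refine ⟨fun i a => v i fun j => u j a, fun i => hC.2 _ _ _ _ (hv i) hu, fun a => ?_⟩
  rw [hfu, hgv]

theorem Subfn.refl' {C : Set (Op A)} (hC : IsClone C) (f : Op A) : Subfn C f f :=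
  ⟨fun i a => a i, fun i => hC.1 _ i, fun _ => rfl⟩

theorem no_chain {C : Set (Op A)} (hC : IsClone C)
    (hfin : ∀ g : Op A, ∃ (T : Type) (_ : Finite T) (P : Op A → T → Prop),
      (∀ f, Subfn C f g → ∃ t, P f t) ∧ ∀ f f' t, P f t → P f' t → Subfn C f f') :
    ¬ ∃ f : ℕ → Op A, ∀ n : ℕ, ProperSubfn C (f (n + 1)) (f n) := by
  rintro ⟨f, hf⟩
  have hmono : ∀ n d, Subfn C (f (n + d)) (f n) := by
    intro n d
    induction d with
    | zero => exact Subfn.refl' hC _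
    | succ d ih => exact Subfn.trans' hC (hf (n + d)).1 ih
  obtain ⟨T, hT, P, hP1, hP2⟩ := hfin (f 0)
  have : ∀ n, ∃ t, P (f n) t := fun n => hP1 _ (by simpa using hmono 0 n)
  choose t ht using this
  obtain ⟨a, b, hab, htab⟩ := Finite.exists_ne_map_eq_of_infinite t
  have key : ∀ a b, a < b → t a = t b → False := by
    intro a b hab htab
    obtain ⟨d, rfl⟩ := Nat.exists_eq_add_of_lt hab
    have h1 : Subfn C (f a) (f (a + d + 1)) := hP2 _ _ (t a) (ht a) (htab ▸ ht _)
    have h2 := hmono (a + 1) d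
    rw [show a + 1 + d = a + d + 1 by ring] at h2
    exact (hf a).2 (Subfn.trans' hC h1 h2)
  rcases lt_or_gt_of_ne hab with h | h
  · exact key a b h htab
  · exact key b a h htab.symm

/- ### Case 0 -/

theorem isClone_cloneGen (S : Set (Op A)) : IsClone (cloneGen S) := by
  refine ⟨fun n i C hC => hC.1.1 n i, fun n m f g hf hg C hC => ?_⟩
  exact hC.1.2 n m f g (hf C hC) fun i => hg i C hC

theorem mem_B0 {f : Op A} (hf : f ∈ B A 0) : ∃ (l : Fin f.1) (u : A → A), ∀ x, f.2 x = u (x l) := by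
  refine hf {f | ∃ (l : Fin f.1) (u : A → A), ∀ x, f.2 x = u (x l)} ⟨⟨?_, ?_⟩, ?_⟩
  · intro n i; exact ⟨i, id, fun _ => rfl⟩
  · rintro n m f g ⟨l, u, h⟩ hg
    obtain ⟨l', u', h'⟩ := hg l
    refine ⟨l', fun v => u (u' v), fun x => ?_⟩
    simp only at h h' ⊢
    rw [h, h']
  · rintro ⟨n, f⟩ hn
    have : n = 1 := hn
    subst this
    refine ⟨0, fun v => f fun _ => v, fun x => ?_⟩
    simp only
    congr 1; funext i; rw [Subsingleton.elim i 0]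

theorem case0 {A : Type} [Finite A] :
    ¬ ∃ f : ℕ → Op A, ∀ n : ℕ, ProperSubfn (B A 0) (f (n + 1)) (f n) := by
  have hC : IsClone (B A 0) := isClone_cloneGen _
  apply no_chain hC
  rintro ⟨m, g⟩
  refine ⟨(Fin m → A → A) × (Fin m → Fin m → Prop) × Prop, inferInstance,
    fun f t => (t.2.2 ↔ f.1 = 0) ∧ ∃ σ : Fin m → Fin f.1,
      (∀ j j', t.2.1 j j' ↔ σ j = σ j') ∧ ∀ x, f.2 x = g fun j => t.1 j (x (σ j)), ?_, ?_⟩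
  · rintro ⟨n, f⟩ ⟨h, hh, hf⟩
    choose σ u hu using fun j => mem_B0 (hh j)
    refine ⟨(u, fun j j' => σ j = σ j', n = 0), Iff.rfl, σ, fun _ _ => Iff.rfl, fun x => ?_⟩
    rw [hf]
    simp only at hu ⊢
    congr 1; funext j; exact hu j x
  · rintro ⟨n, f⟩ ⟨n', f'⟩ ⟨u, r, b⟩ ⟨hb, σ, hr, hf⟩ ⟨hb', σ', hr', hf'⟩
    simp only at *
    have : ∀ l' : Fin n', ∃ l : Fin n, ∀ j, σ' j = l' → σ j = l := by
      intro l'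
      by_cases h : ∃ j, σ' j = l'
      · obtain ⟨j, hj⟩ := h
        refine ⟨σ j, fun j2 hj2 => ?_⟩
        rw [← hr, hr', hj2, hj]
      · push Not at h
        have hn : n ≠ 0 := by
          intro h0
          have h1 := hb'.1 (hb.2 h0)
          exact absurd l'.2 (by omega)
        exact ⟨⟨0, Nat.pos_of_ne_zero hn⟩, fun j hj => absurd hj (h j)⟩
    choose ρ hρ using this
    refine ⟨fun l' x => x (ρ l'), fun l' => hC.1 n _, fun x => ?_⟩
    simp only
    rw [hf, hf']
    congr 1; funext j; rw [hρ _ j rfl]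

/- ### Large cases -/

theorem isClone_B_big [Finite A] (i : ℕ) : IsClone (B A (i + 2)) := by
  refine ⟨fun n l => Or.inl (essUnary_unary l id), ?_⟩
  rintro n m f g (hf | hf) hg
  · rcases essUnary_cases f hf with ⟨c, hc⟩ | ⟨l, u, hu⟩
    · exact Or.inl (essUnary_of_const (c := c) fun x => hc _)
    · rcases hg l with h | h
      · rcases essUnary_cases _ h with ⟨c, hc⟩ | ⟨l', u', hu'⟩
        · exact Or.inl (essUnary_of_const (c := u c) fun x => by rw [hu, hc])
        · exact Or.inl (essUnary_of_unary (l := l') (u := fun v => u (u' v))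
            fun x => by rw [hu, hu'])
      · right
        have : rng (⟨m, fun a => f fun i => g i a⟩ : Op A) = u '' rng (⟨m, g l⟩ : Op A) := by
          ext v
          simp [rng, hu]
        rw [this]
        exact (Set.ncard_image_le (Set.toFinite _)).trans h
  · right
    refine le_trans (Set.ncard_le_ncard ?_ (Set.toFinite _)) hf
    rintro _ ⟨x, rfl⟩
    exact ⟨_, rfl⟩

theorem jablonskii {A : Type} [Finite A] (h3 : ∃ x y z : A, x ≠ y ∧ x ≠ z ∧ y ≠ z) {n : ℕ}
    (f : (Fin n → A) → A) (hf : Function.Surjective f) (hu : ¬ EssUnary ⟨n, f⟩) :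
    ∃ a : A → Fin n → A, (∀ v, f (a v) = v) ∧ ∀ j, ¬ Function.Injective fun v => a v j := by
  classical
  have third : ∀ p q : A, ∃ r, r ≠ p ∧ r ≠ q := by
    obtain ⟨x, y, z, h1, h2, h4⟩ := h3
    intro p q
    by_contra! h
    have ex : x = p ∨ x = q := or_iff_not_imp_left.2 (h x)
    have ey : y = p ∨ y = q := or_iff_not_imp_left.2 (h y)
    have ez : z = p ∨ z = q := or_iff_not_imp_left.2 (h z)
    grind
  -- three points
  have main : ∃ (i : Fin n) (a b : A) (c d : Fin n → A),
      f (Function.update c i a) ≠ f (Function.update c i b) ∧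
      f (Function.update c i a) ≠ f (Function.update d i a) ∧
      f (Function.update c i b) ≠ f (Function.update d i a) := by
    have hi : ∃ i, essAt f i := by
      by_contra! h
      exact hu fun i hi => absurd hi (h i)
    obtain ⟨i, x, y, hxy, hne⟩ := hi
    have hc : ∃ c : Fin n → A, ∃ a b, f (Function.update c i a) ≠ f (Function.update c i b) := by
      refine ⟨x, x i, y i, ?_⟩
      have : Function.update x i (y i) = y := by
        funext j
        by_cases hj : j = i
        · subst hj; simp
        · rw [Function.update_of_ne hj]; exact hxy j hj
      rw [this]; simpa using hne
    obtain ⟨c, a1, b1, hab⟩ := hc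
    by_cases hfull : ∀ v, ∃ a, f (Function.update c i a) = v
    · have : ∃ a d, f (Function.update c i a) ≠ f (Function.update d i a) := by
        by_contra! h
        apply hu
        refine essUnary_of_unary (l := i) (u := fun a => f (Function.update c i a)) fun x => ?_
        rw [h (x i) x]; simp
      obtain ⟨a, d, had⟩ := this
      obtain ⟨r, hr1, hr2⟩ := third (f (Function.update c i a)) (f (Function.update d i a))
      obtain ⟨b, hb⟩ := hfull r
      exact ⟨i, a, b, c, d, by rw [hb]; exact hr1.symm, had, by rw [hb]; exact hr2⟩
    · push Not at hfull
      obtain ⟨v, hv⟩ := hfull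
      obtain ⟨d, hd⟩ := hf v
      have hd' : f (Function.update d i (d i)) = v := by simpa using hd
      have : ∃ b, f (Function.update c i (d i)) ≠ f (Function.update c i b) := by
        by_contra! h
        exact hab ((h a1).symm.trans (h b1))
      obtain ⟨b, hb⟩ := this
      exact ⟨i, d i, b, c, d, hb, by rw [hd']; exact hv _, by rw [hd']; exact hv _⟩
  obtain ⟨i, a, b, c, d, h1, h2, h4⟩ := main
  choose s hs using hf
  refine ⟨fun v => if v = f (Function.update c i a) then Function.update c i a
    else if v = f (Function.update c i b) then Function.update c i b
    else if v = f (Function.update d i a) then Function.update d i a else s v, ?_, ?_⟩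
  · intro v
    simp only
    split_ifs with h h h
    · exact h.symm
    · exact h.symm
    · exact h.symm
    · exact hs v
  · intro j hinj
    by_cases hj : j = i
    · subst hj
      apply h2
      apply hinj
      simp [h2.symm, h4.symm]
    · apply h1
      apply hinj
      simp [h1.symm, hj]

theorem big_case {A : Type} [Finite A] (i : ℕ) (hk : Nat.card A ≤ i + 2 + 1)
    (h2 : ∃ x y : A, x ≠ y)
    (h3 : (∃ x y z : A, x ≠ y ∧ x ≠ z ∧ y ≠ z) ∨ Nat.card A ≤ i + 2) :
    ¬ ∃ f : ℕ → Op A, ∀ n : ℕ, ProperSubfn (B A (i + 2)) (f (n + 1)) (f n) := by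
  classical
  obtain ⟨x0, y0, hxy0⟩ := h2
  apply no_chain (isClone_B_big i)
  intro g
  refine ⟨Option (Set A), inferInstance, fun f t => match t with
    | some R => rng f = R ∧ ∀ f' : Op A, rng f' ⊆ R → Subfn (B A (i + 2)) f' f
    | none => ∃ (l : Fin f.1) (u : A → A), Function.Bijective u ∧ ∀ x, f.2 x = u (x l), ?_, ?_⟩
  · rintro ⟨n, f⟩ -
    have tr : ∀ a : A → Fin n → A, (∀ v ∈ Set.range f, f (a v) = v) →
        (∀ j, (Set.range fun v => a v j).ncard ≤ i + 2) →
        ∀ f' : Op A, rng f' ⊆ Set.range f → Subfn (B A (i + 2)) f' ⟨n, f⟩ := by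
      intro a ha hj f' hf'
      refine ⟨fun j x => a (f'.2 x) j, fun j => Or.inr ?_, fun x => ?_⟩
      · refine le_trans (Set.ncard_le_ncard ?_ (Set.toFinite _)) (hj j)
        rintro _ ⟨x, rfl⟩
        exact ⟨_, rfl⟩
      · exact (ha _ (hf' ⟨x, rfl⟩)).symm
    have ninj : ∀ w : A → A, ¬ Function.Injective w → (Set.range w).ncard ≤ i + 2 := by
      intro w hw
      have h1 : (Set.range w).ncard < (Set.univ : Set A).ncard := by
        apply Set.ncard_lt_ncard _ (Set.toFinite _)
        rw [Set.ssubset_univ_iff]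
        intro h
        exact hw (Finite.injective_iff_surjective.2 (Set.range_eq_univ.1 h))
      rw [Set.ncard_univ] at h1
      omega
    by_cases hle : Nat.card A ≤ i + 2
    · refine ⟨some (Set.range f), rfl, ?_⟩
      have : ∀ v, ∃ a, v ∈ Set.range f → f a = v := by
        intro v
        by_cases h : v ∈ Set.range f
        · obtain ⟨a, ha⟩ := h; exact ⟨a, fun _ => ha⟩
        · exact ⟨fun _ => x0, fun h' => absurd h' h⟩
      choose a ha using this
      apply tr a ha
      intro j
      refine le_trans (Set.ncard_le_ncard (Set.subset_univ _) (Set.toFinite _)) ?_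
      rwa [Set.ncard_univ]
    have h3 := h3.resolve_right hle
    by_cases hsurj : Function.Surjective f
    · by_cases hu : EssUnary ⟨n, f⟩
      · refine ⟨none, ?_⟩
        rcases essUnary_cases f hu with ⟨c, hc⟩ | ⟨l, u, hu⟩
        · exfalso
          obtain ⟨a, ha⟩ := hsurj x0
          obtain ⟨b, hb⟩ := hsurj y0
          exact hxy0 (by rw [← ha, ← hb, hc, hc])
        · refine ⟨l, u, ?_, hu⟩
          have : Function.Surjective u := by
            intro v
            obtain ⟨a, ha⟩ := hsurj v
            exact ⟨a l, by rw [← hu, ha]⟩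
          exact ⟨Finite.injective_iff_surjective.2 this, this⟩
      · obtain ⟨a, ha, hj⟩ := jablonskii h3 f hsurj hu
        exact ⟨some (Set.range f), rfl, tr a (fun v _ => ha v) fun j => ninj _ (hj j)⟩
    · refine ⟨some (Set.range f), rfl, ?_⟩
      have : ∃ v, v ∉ Set.range f := by
        by_contra! h
        exact hsurj h
      obtain ⟨v0, hv0⟩ := this
      have hv1 : f (fun _ => x0) ≠ v0 := fun h => hv0 ⟨_, h⟩
      have : ∀ v, ∃ a, v ∈ Set.range f → f a = v := by
        intro v
        by_cases h : v ∈ Set.range f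
        · obtain ⟨a, ha⟩ := h; exact ⟨a, fun _ => ha⟩
        · exact ⟨fun _ => x0, fun h' => absurd h' h⟩
      choose a ha using this
      refine tr (fun v => if v = v0 then a (f fun _ => x0) else a v) ?_ ?_
      · intro v hv
        have : v ≠ v0 := fun h => hv0 (h ▸ hv)
        simp only [this, if_false]
        exact ha v hv
      · intro j
        apply ninj
        intro hinj
        apply hv1
        apply hinj
        simp
  · rintro ⟨n, f⟩ ⟨n', f'⟩ (_ | R)
    · rintro ⟨l, u, hu, hf⟩ ⟨l', u', hu', hf'⟩
      obtain ⟨w, hw⟩ := hu'.2.hasRightInverse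
      refine ⟨fun _ x => w (u (x l)), fun j => Or.inl (essUnary_unary l fun v => w (u v)), fun x => ?_⟩
      simp only at hf hf' ⊢
      rw [hf, hf', hw]
    · rintro ⟨h1, h2⟩ ⟨h1', h2'⟩
      exact h2' _ h1.le

/- ### Descending chain -/

open Classical in
noncomputable def FF (k : ℕ) [NeZero k] (N : ℕ) : (Fin (N + 1) → Fin k) → Fin k :=
  fun x => if x 0 = 0 then 0 else
    if ∃ t : Fin N, ∀ j : Fin N, j ≠ t → x j.succ = 1 then 1 else
    if h : ∃ v, ∀ j : Fin N, x j.succ = v then h.choose else 0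

theorem FF_zero {k : ℕ} [NeZero k] {N : ℕ} {x : Fin (N + 1) → Fin k} (h : x 0 = 0) :
    FF k N x = 0 := by
  simp only [FF]; rw [if_pos h]

theorem FF_near {k : ℕ} [NeZero k] {N : ℕ} {x : Fin (N + 1) → Fin k} (h : x 0 ≠ 0)
    (t : Fin N) (ht : ∀ j : Fin N, j ≠ t → x j.succ = 1) : FF k N x = 1 := by
  simp only [FF]; rw [if_neg h, if_pos ⟨t, ht⟩]

theorem FF_const {k : ℕ} [NeZero k] {N : ℕ} {x : Fin (N + 1) → Fin k} (h : x 0 ≠ 0) (hN : 2 ≤ N)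
    (v : Fin k) (hv : ∀ j : Fin N, x j.succ = v) : FF k N x = v := by
  have hN1 : 1 < N := hN
  by_cases hv1 : v = 1
  · subst hv1
    exact FF_near h ⟨0, by omega⟩ fun j _ => hv j
  · simp only [FF]
    rw [if_neg h, if_neg, dif_pos ⟨v, hv⟩]
    · have := (⟨v, hv⟩ : ∃ v, ∀ j : Fin N, x j.succ = v).choose_spec ⟨0, by omega⟩
      rw [← this, hv]
    · rintro ⟨t, ht⟩
      have : ∃ j : Fin N, j ≠ t := by
        by_cases h0 : t = ⟨0, by omega⟩
        · exact ⟨⟨1, hN1⟩, by rw [h0]; simp [Fin.ext_iff]⟩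
        · exact ⟨_, fun e => h0 e.symm⟩
      obtain ⟨j, hj⟩ := this
      exact hv1 ((hv j).symm.trans (ht j hj))

theorem FF_ne_zero {k : ℕ} [NeZero k] {N : ℕ} {x : Fin (N + 1) → Fin k}
    (h : FF k N x ≠ 0) : x 0 ≠ 0 ∧
      ((FF k N x = 1 ∧ ∃ t : Fin N, ∀ j : Fin N, j ≠ t → x j.succ = 1) ∨
        ∀ j : Fin N, x j.succ = FF k N x) := by
  by_cases h0 : x 0 = 0
  · exact absurd (FF_zero h0) h
  refine ⟨h0, ?_⟩
  by_cases h1 : ∃ t : Fin N, ∀ j : Fin N, j ≠ t → x j.succ = 1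
  · obtain ⟨t, ht⟩ := h1
    exact Or.inl ⟨FF_near h0 t ht, t, ht⟩
  · right
    by_cases h2 : ∃ v, ∀ j : Fin N, x j.succ = v
    · have : FF k N x = h2.choose := by
        simp only [FF]; rw [if_neg h0, if_neg h1, dif_pos h2]
      rw [this]; exact h2.choose_spec
    · exfalso; apply h
      simp only [FF]; rw [if_neg h0, if_neg h1, dif_neg h2]

theorem FF_sub {k : ℕ} [NeZero k] (hk : 2 ≤ k) (i : ℕ) (N : ℕ) (hN : 2 ≤ N) :
    Subfn (B (Fin k) (i + 2)) ⟨N + 1 + 1, FF k (N + 1)⟩ ⟨N + 1, FF k N⟩ := by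
  classical
  have h10 : (1 : Fin k) ≠ 0 := by
    intro h
    have := congrArg Fin.val h
    rw [Fin.val_one', Fin.val_zero, Nat.mod_eq_of_lt (by omega)] at this
    omega
  refine ⟨Fin.cons (fun x => if FF k (N + 1) x = 0 then 0 else 1)
    (fun j x => x j.succ.castSucc), ?_, ?_⟩
  · intro j
    refine Fin.cases ?_ (fun j => ?_) j
    · right
      have : rng (⟨N + 1 + 1, fun x => if FF k (N + 1) x = 0 then 0 else 1⟩ : Op (Fin k)) ⊆
          {0, 1} := by
        rintro _ ⟨x, rfl⟩
        simp only
        split_ifs <;> simp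
      refine le_trans (Set.ncard_le_ncard this (Set.toFinite _)) ?_
      exact (Set.ncard_insert_le _ _).trans (by simp)
    · left
      exact essUnary_unary (A := Fin k) _ id
  · intro x
    set y : Fin (N + 1) → Fin k := fun j => (Fin.cons (fun x => if FF k (N + 1) x = 0 then 0 else 1)
      (fun j x => x j.succ.castSucc) : Fin (N + 1) → (Fin (N + 1 + 1) → Fin k) → Fin k) j x with hy
    have hy0 : y 0 = if FF k (N + 1) x = 0 then 0 else 1 := rfl
    have hys : ∀ j : Fin N, y j.succ = x j.castSucc.succ := fun j => by
      simp [hy]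
    change FF k (N + 1) x = FF k N y
    by_cases h : FF k (N + 1) x = 0
    · rw [h, FF_zero]; rw [hy0, if_pos h]
    · have hy0' : y 0 ≠ 0 := by rw [hy0, if_neg h]; exact h10
      obtain ⟨-, ⟨h1, t, ht⟩ | h1⟩ := FF_ne_zero h
      · rw [h1]; symm
        by_cases htl : ∃ s : Fin N, t = s.castSucc
        · obtain ⟨s, rfl⟩ := htl
          refine FF_near hy0' s fun j hj => ?_
          rw [hys]; exact ht _ fun e => hj (Fin.castSucc_injective _ e)
        · refine FF_near hy0' ⟨0, by omega⟩ fun j _ => ?_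
          rw [hys]; exact ht _ fun e => htl ⟨j, e.symm⟩
      · symm
        refine FF_const hy0' hN _ fun j => ?_
        rw [hys, h1]

theorem FF_not_sub {k : ℕ} [NeZero k] (i : ℕ) (hik : i + 2 + 2 ≤ k) (N : ℕ) (hN : 2 ≤ N) :
    ¬ Subfn (B (Fin k) (i + 2)) ⟨N + 1, FF k N⟩ ⟨N + 1 + 1, FF k (N + 1)⟩ := by
  classical
  rintro ⟨h, hB, hF⟩
  change Fin (N + 1 + 1) → (Fin (N + 1) → Fin k) → Fin k at h
  change ∀ j, (⟨N + 1, h j⟩ : Op (Fin k)) ∈ B (Fin k) (i + 2) at hB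
  change ∀ a, FF k N a = FF k (N + 1) fun j => h j a at hF
  have v1 : ((1 : Fin k) : ℕ) = 1 := by
    rw [Fin.val_one', Nat.mod_eq_of_lt (by omega)]
  have h10 : (1 : Fin k) ≠ 0 := by
    intro h
    have := congrArg Fin.val h
    rw [v1, Fin.val_zero] at this
    omega
  obtain ⟨w, hw0, hw1⟩ : ∃ w : Fin k, w ≠ 0 ∧ w ≠ 1 := by
    refine ⟨⟨2, by omega⟩, ?_, ?_⟩ <;> intro e <;> have := congrArg Fin.val e
    · simp at this
    · rw [v1] at this; simp at this
  let p : Fin k → Fin (N + 1) → Fin k := fun v => Fin.cons 1 fun _ => v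
  let e : Fin N → Fin (N + 1) → Fin k := fun l => Fin.cons 1 fun j => if j = l then w else 1
  have hp : ∀ v, FF k N (p v) = v := fun v => FF_const (x := p v) h10 hN v fun j => rfl
  have he : ∀ l, FF k N (e l) = 1 := fun l =>
    FF_near (x := e l) h10 l fun j hj => by simp [e, hj]
  have hpv : ∀ v, v ≠ 0 → v ≠ 1 → ∀ j : Fin (N + 1), h j.succ (p v) = v := by
    intro v hv0 hv1 j
    have h1 : FF k (N + 1) (fun j => h j (p v)) = v := by rw [← hF, hp]
    obtain ⟨-, ⟨h2, -⟩ | h2⟩ := FF_ne_zero (x := fun j => h j (p v)) (by rw [h1]; exact hv0)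
    · exact absurd (h1.symm.trans h2) hv1
    · rw [h1] at h2; exact h2 j
  have one : ∀ x, FF k N x = 1 → ∃ t : Fin (N + 1), ∀ j, j ≠ t → h j.succ x = 1 := by
    intro x hx
    have h1 : FF k (N + 1) (fun j => h j x) = 1 := by rw [← hF, hx]
    obtain ⟨-, ⟨-, h2⟩ | h2⟩ := FF_ne_zero (x := fun j => h j x) (by rw [h1]; exact h10)
    · exact h2
    · rw [h1] at h2; exact ⟨0, fun j _ => h2 j⟩
  have key : ∀ (j : Fin (N + 1)) (q : Fin (N + 1) → Fin k), q 0 = 1 → h j.succ q = 1 →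
      ∃ l, h j.succ (e l) = w := by
    intro j q hq0 hq
    have hEss : EssUnary (⟨N + 1, h j.succ⟩ : Op (Fin k)) := by
      rcases hB j.succ with h1 | h1
      · exact h1
      · exfalso
        have hsub : ({0}ᶜ : Set (Fin k)) ⊆ rng (⟨N + 1, h j.succ⟩ : Op (Fin k)) := by
          intro v hv
          by_cases hv1 : v = 1
          · exact ⟨q, by rw [hv1]; exact hq⟩
          · exact ⟨p v, hpv v hv hv1 j⟩
        have h2 := Set.ncard_le_ncard hsub (Set.toFinite _)
        rw [Set.ncard_compl, Nat.card_fin, Set.ncard_singleton] at h2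
        have h3 := h2.trans h1
        omega
    rcases essUnary_cases _ hEss with ⟨c, hc⟩ | ⟨s, u, hu⟩
    · exfalso
      exact hw1 (by rw [← hpv w hw0 hw1 j, hc, ← hc q, hq])
    · have hs : s ≠ 0 := by
        rintro rfl
        apply hw1
        rw [← hpv w hw0 hw1 j, hu, ← hq, hu, hq0]; rfl
      obtain ⟨l, rfl⟩ := Fin.exists_succ_eq.2 hs
      refine ⟨l, ?_⟩
      rw [hu, ← hpv w hw0 hw1 j, hu]
      simp [e, p]
  obtain ⟨t, ht⟩ := one (p 1) (hp 1)
  choose T hT using fun l => one (e l) (he l)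
  have hTj : ∀ j, j ≠ t → ∃ l, T l = j := by
    intro j hj
    obtain ⟨l, hl⟩ := key j (p 1) rfl (ht j hj)
    refine ⟨l, ?_⟩
    by_contra hne
    exact hw1 (hl.symm.trans (hT l j fun e => hne e.symm))
  have hTt : ∀ l, T l ≠ t := by
    intro l hl
    have hs : Function.Surjective T := by
      intro j
      by_cases hj : j = t
      · exact ⟨l, hl.trans hj.symm⟩
      · exact hTj j hj
    have := Fintype.card_le_of_surjective T hs
    simp at this
  have h1 : ∀ l, h t.succ (e l) = 1 := fun l => hT l t fun e => hTt l e.symm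
  obtain ⟨l, hl⟩ := key t (e ⟨0, by omega⟩) rfl (h1 _)
  exact hw1 (hl.symm.trans (h1 l))


/- ### Case 1 -/

theorem ql_mk {n : ℕ} {f : (Fin n → A) → A} (h : Fin n → A → ZMod 2) (g : ZMod 2 → A)
    (hf : ∀ x, f x = g (∑ i, h i (x i))) : (⟨n, f⟩ : Op A) ∈ B A 1 :=
  Or.inr ⟨h, g, hf⟩

theorem mem_B1 {n : ℕ} {f : (Fin n → A) → A} (hf : (⟨n, f⟩ : Op A) ∈ B A 1) :
    (∃ (l : Fin n) (u : A → A), ∀ x, f x = u (x l)) ∨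
    ∃ (h : Fin n → A → ZMod 2) (g : ZMod 2 → A), ∀ x, f x = g (∑ i, h i (x i)) := by
  rcases hf with h | ⟨h, g, hg⟩
  · rcases essUnary_cases f h with ⟨c, hc⟩ | h
    · exact Or.inr ⟨0, fun _ => c, hc⟩
    · exact Or.inl h
  · exact Or.inr ⟨h, g, hg⟩

theorem zmod2_aff (φ : ZMod 2 → ZMod 2) (s : ZMod 2) : φ s = φ 0 + (φ 1 - φ 0) * s := by
  have : s = 0 ∨ s = 1 := by revert s; decide
  rcases this with rfl | rfl <;> ring

theorem B1_aff {n : ℕ} {f : (Fin n → A) → A} (hf : (⟨n, f⟩ : Op A) ∈ B A 1) (φ : A → ZMod 2) :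
    ∃ (c : ZMod 2) (ψ : Fin n → A → ZMod 2), ∀ x, φ (f x) = c + ∑ l, ψ l (x l) := by
  classical
  rcases mem_B1 hf with ⟨l, u, h⟩ | ⟨h, g, hg⟩
  · refine ⟨0, fun l' a => if l' = l then φ (u a) else 0, fun x => ?_⟩
    simp [h]
  · refine ⟨φ (g 0), fun l a => (φ (g 1) - φ (g 0)) * h l a, fun x => ?_⟩
    rw [hg, zmod2_aff (fun s => φ (g s)), Finset.mul_sum]

theorem isClone_B1 : IsClone (B A 1) := by
  refine ⟨fun n l => Or.inl (essUnary_unary l id), ?_⟩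
  intro n m f g hf hg
  rcases mem_B1 hf with ⟨l, u, h⟩ | ⟨h, v, hv⟩
  · rcases mem_B1 (hg l) with ⟨l', u', h'⟩ | ⟨h', v', hv'⟩
    · exact Or.inl (essUnary_of_unary (l := l') (u := fun a => u (u' a)) fun x => by rw [h, h'])
    · exact ql_mk h' (fun s => u (v' s)) fun x => by rw [h, hv']
  · choose c ψ hψ using fun j => B1_aff (hg j) (h j)
    refine ql_mk (fun l a => ∑ j, ψ j l a) (fun s => v ((∑ j, c j) + s)) fun x => ?_
    rw [hv]
    simp only [hψ]
    rw [Finset.sum_add_distrib, Finset.sum_comm]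

theorem local_lemma {A : Type} [Fintype A] (a0 : A) (hA : 2 ≤ Fintype.card A)
    (L L' : Type) [Fintype L] [Fintype L']
    (hc : Fintype.card L = Fintype.card L' ∨ (Fintype.card A ≤ Fintype.card L ∧
      Fintype.card A ≤ Fintype.card L' ∧ Fintype.card L % 2 = Fintype.card L' % 2)) :
    ∃ Y : L' → (L → A) → A,
      (∀ l', (∃ l, ∀ x, Y l' x = x l) ∨
        ∃ (hh : L → A → ZMod 2) (gg : ZMod 2 → A), ∀ x, Y l' x = gg (∑ l, hh l (x l))) ∧
      (∀ (φ : A → ZMod 2) x, ∑ l', φ (Y l' x) = ∑ l, φ (x l)) ∧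
      (∀ l' l x, (∀ l2 : L, l2 = l) → Y l' x = x l) := by
  classical
  rcases hc with hc | ⟨h1, h2, h3⟩
  · let e : L' ≃ L := (Fintype.equivOfCardEq hc).symm
    refine ⟨fun l' x => x (e l'), fun l' => Or.inl ⟨e l', fun x => rfl⟩, fun φ x => ?_, ?_⟩
    · exact Equiv.sum_comp e fun l => φ (x l)
    · intro l' l x hl
      simp only
      rw [hl (e l')]
  · obtain ⟨b⟩ := Function.Embedding.nonempty_of_card_le h2
    have hY : ∀ l', ∃ Yl : (L → A) → A,
        (∃ (hh : L → A → ZMod 2) (gg : ZMod 2 → A), ∀ x, Yl x = gg (∑ l, hh l (x l))) ∧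
        (∀ (φ : A → ZMod 2) x, φ (Yl x) - φ a0 =
          ∑ a, if b a = l' then (∑ l, if x l = a then 1 else 0) * (φ a - φ a0) else 0) := by
      intro l'
      by_cases h : ∃ a, b a = l'
      · obtain ⟨a, rfl⟩ := h
        refine ⟨fun x => if (∑ l, if x l = a then (1 : ZMod 2) else 0) = 0 then a0 else a,
          ⟨fun _ v => if v = a then 1 else 0, fun s => if s = 0 then a0 else a, fun x => rfl⟩, ?_⟩
        intro φ x
        simp only [b.injective.eq_iff, Finset.sum_ite_eq', Finset.mem_univ, if_true]
        generalize (∑ l, if x l = a then (1 : ZMod 2) else 0) = s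
        have : s = 0 ∨ s = 1 := by revert s; decide
        rcases this with rfl | rfl <;> simp
      · push Not at h
        refine ⟨fun _ => a0, ⟨0, fun _ => a0, fun _ => rfl⟩, fun φ x => ?_⟩
        simp [h]
    choose Y hY1 hY2 using hY
    refine ⟨Y, fun l' => Or.inr (hY1 l'), fun φ x => ?_, ?_⟩
    · have e1 : ∑ l', φ (Y l' x) = ∑ l', (φ (Y l' x) - φ a0) + (Fintype.card L' : ZMod 2) * φ a0 := by
        simp [Finset.sum_sub_distrib]
      have e2 : ∑ l', (φ (Y l' x) - φ a0) = ∑ l, (φ (x l) - φ a0) := by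
        simp only [hY2]
        rw [Finset.sum_comm]
        simp only [Finset.sum_ite_eq, Finset.mem_univ, if_true, Finset.sum_mul]
        rw [Finset.sum_comm]
        simp
      have e3 : (Fintype.card L' : ZMod 2) = Fintype.card L := by
        rw [ZMod.natCast_eq_natCast_iff]
        exact h3.symm
      rw [e1, e2, e3]
      simp [Finset.sum_sub_distrib]
    · intro l' l x hl
      exfalso
      have : Fintype.card L ≤ 1 := Fintype.card_le_one_iff.2 fun a b => (hl a).trans (hl b).symm
      omega

theorem comb_lemma {A : Type} [Fintype A] (a0 : A) (hA : 2 ≤ Fintype.card A) {T : Type} [Fintype T]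
    [DecidableEq T]
    {n n' : ℕ} (ty : Fin n → T) (ty' : Fin n' → T)
    (hc : ∀ τ, Fintype.card {l // ty l = τ} = Fintype.card {l // ty' l = τ} ∨
      (Fintype.card A ≤ Fintype.card {l // ty l = τ} ∧
      Fintype.card A ≤ Fintype.card {l // ty' l = τ} ∧
      Fintype.card {l // ty l = τ} % 2 = Fintype.card {l // ty' l = τ} % 2)) :
    ∃ Y : Fin n' → (Fin n → A) → A,
      (∀ l', (⟨n, Y l'⟩ : Op A) ∈ B A 1) ∧
      (∀ (ψ : T → A → ZMod 2) x, ∑ l', ψ (ty' l') (Y l' x) = ∑ l, ψ (ty l) (x l)) ∧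
      (∀ l' l x, ty l = ty' l' → (∀ l2, ty l2 = ty l → l2 = l) → Y l' x = x l) := by
  classical
  choose Z hZ1 hZ2 hZ3 using fun τ => local_lemma a0 hA _ _ (hc τ)
  refine ⟨fun l' x => Z (ty' l') ⟨l', rfl⟩ fun l => x l.1, fun l' => ?_, fun ψ x => ?_, ?_⟩
  · rcases hZ1 (ty' l') ⟨l', rfl⟩ with ⟨l, hl⟩ | ⟨hh, gg, h⟩
    · exact Or.inl (essUnary_of_unary (l := l.1) (u := id) fun x => hl _)
    · refine ql_mk (fun l v => if h : ty l = ty' l' then hh ⟨l, h⟩ v else 0) gg fun x => ?_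
      refine (h _).trans ?_
      congr 1
      refine Fintype.sum_of_injective Subtype.val Subtype.val_injective _ _ ?_ ?_
      · intro l hl
        have hl' : ¬ ty l = ty' l' := fun e => hl ⟨⟨l, e⟩, rfl⟩
        simp [hl']
      · intro l
        simp [l.2]
  · have key : ∀ {m : ℕ} (t : Fin m → T) (F : Fin m → ZMod 2),
        ∑ l, F l = ∑ τ, ∑ l : {l // t l = τ}, F l.1 := by
      intro m t F
      rw [Fintype.sum_fiberwise]
    rw [key ty', key ty]
    refine Finset.sum_congr rfl fun τ _ => ?_
    have : ∀ l : {l // ty l = τ}, ψ (ty l.1) (x l.1) = ψ τ (x l.1) := fun l => by rw [l.2]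
    simp only [this]
    rw [← hZ2 τ (ψ τ) fun l => x l.1]
    refine Finset.sum_congr rfl fun l' _ => ?_
    obtain ⟨l', rfl⟩ := l'
    rfl
  · intro l' l x h1 h2
    exact hZ3 (ty' l') ⟨l', rfl⟩ ⟨l, h1⟩ _ fun l2 => Subtype.ext (h2 l2.1 (l2.2.trans h1.symm))

theorem cap_eq {k c c' : ℕ} (h : (if c < k then c else k + c % 2) = if c' < k then c' else k + c' % 2) :
    c = c' ∨ (k ≤ c ∧ k ≤ c' ∧ c % 2 = c' % 2) := by
  split_ifs at h <;> omega

theorem case1 {A : Type} [Fintype A] (a0 : A) (hA : 2 ≤ Fintype.card A) :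
    ¬ ∃ f : ℕ → Op A, ∀ n : ℕ, ProperSubfn (B A 1) (f (n + 1)) (f n) := by
  classical
  apply no_chain isClone_B1
  rintro ⟨m, g⟩
  let Ty := (Fin m → A → ZMod 2) × (Fin m → Bool)
  refine ⟨(Fin m → Bool) × (Fin m → A → A) × (Fin m → ZMod 2 → A) × (Ty → Fin (Fintype.card A + 2)),
    inferInstance,
    fun f t => ∃ ty : Fin f.1 → Ty, (∀ j, t.1 j = true → ∃ l, (ty l).2 j = true ∧
        ∀ l2, (ty l2).2 j = true → l2 = l) ∧
      (∀ x y, (∀ j, t.1 j = true → ∀ l, (ty l).2 j = true → y j = t.2.1 j (x l)) →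
        (∀ j, ¬ t.1 j = true → y j = t.2.2.1 j (∑ l, (ty l).1 j (x l))) → f.2 x = g y) ∧
      ∀ τ, (t.2.2.2 τ : ℕ) = if Fintype.card {l // ty l = τ} < Fintype.card A
        then Fintype.card {l // ty l = τ}
        else Fintype.card A + Fintype.card {l // ty l = τ} % 2, ?_, ?_⟩
  · rintro ⟨n, f⟩ ⟨h, hh, hf⟩
    have hdat : ∀ j, ∃ (s : Bool) (P : Fin n → Bool) (u : A → A) (hq : Fin n → A → ZMod 2)
        (gq : ZMod 2 → A), (s = true → ∃ l, P l = true ∧ (∀ l2, P l2 = true → l2 = l) ∧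
          ∀ x, h j x = u (x l)) ∧ (¬ s = true → ∀ x, h j x = gq (∑ l, hq l (x l))) := by
      intro j
      rcases mem_B1 (hh j) with ⟨l, u, hu⟩ | ⟨hq, gq, hg⟩
      · exact ⟨true, fun l' => decide (l' = l), u, 0, fun _ => a0,
          fun _ => ⟨l, by simp, by simp, hu⟩, by simp⟩
      · exact ⟨false, fun _ => false, id, hq, gq, by simp, fun _ => hg⟩
    choose s P u hq gq h1 h2 using hdat
    let ty : Fin n → Ty := fun l => (fun j => hq j l, fun j => P j l)
    refine ⟨(s, u, gq, fun τ => ⟨if Fintype.card {l // ty l = τ} < Fintype.card A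
        then Fintype.card {l // ty l = τ}
        else Fintype.card A + Fintype.card {l // ty l = τ} % 2, ?_⟩), ty, ?_, ?_, ?_⟩
    · split_ifs <;> omega
    · intro j hj
      obtain ⟨l, hl1, hl2, -⟩ := h1 j hj
      exact ⟨l, hl1, hl2⟩
    · intro x y hy1 hy2
      rw [hf]
      change g _ = g _
      congr 1; funext j
      by_cases hj : s j = true
      · obtain ⟨l, hl1, -, hl3⟩ := h1 j hj
        rw [hy1 j hj l hl1]; exact hl3 x
      · rw [hy2 j hj]; exact h2 j hj x
    · intro τ; rfl
  · rintro ⟨n, f⟩ ⟨n', f'⟩ ⟨s, u, gq, cnt⟩ ⟨ty, h1, h2, h3⟩ ⟨ty', h1', h2', h3'⟩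
    have hc := fun τ => cap_eq ((h3 τ).symm.trans (h3' τ))
    obtain ⟨Y, hY1, hY2, hY3⟩ := comb_lemma a0 hA ty ty' hc
    refine ⟨Y, hY1, fun x => ?_⟩
    change Fin n → A at x
    simp only at h1 h2 h1' h2' ⊢
    have hex : ∀ j, ∃ yj, (s j = true → ∀ l, (ty l).2 j = true → yj = u j (x l)) ∧
        (¬ s j = true → yj = gq j (∑ l, (ty l).1 j (x l))) := by
      intro j
      by_cases hj : s j = true
      · obtain ⟨l, hl, hl2⟩ := h1 j hj
        exact ⟨u j (x l), fun _ l2 h => by rw [hl2 l2 h], fun h => absurd hj h⟩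
      · exact ⟨_, fun h => absurd h hj, fun _ => rfl⟩
    choose y hy1 hy2 using hex
    rw [h2 x y hy1 hy2]
    symm
    apply h2' _ y
    · intro j hj l' hl'
      obtain ⟨l, hl, hl2⟩ := h1 j hj
      have hne : 0 < Fintype.card {l // ty l = ty' l'} := by
        have : 0 < Fintype.card {l // ty' l = ty' l'} := Fintype.card_pos_iff.2 ⟨⟨l', rfl⟩⟩
        rcases hc (ty' l') with h | h <;> omega
      obtain ⟨⟨l3, hl3⟩⟩ := Fintype.card_pos_iff.1 hne
      have : l3 = l := hl2 l3 (by rw [hl3]; exact hl')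
      subst this
      rw [hY3 l' l3 x hl3 fun l2 e => hl2 l2 (by rw [e]; exact hl)]
      exact hy1 j hj l3 hl
    · intro j hj
      rw [hy2 j hj, hY2 (fun τ => τ.1 j) x]


/-- Main theorem, part (i): for a `k`-element base set (`k ≥ 2`), the poset of
`B_i`-subfunctions admits an infinite descending chain iff `2 ≤ i ≤ k - 2`. -/
theorem descending_chain_iff (k : ℕ) (hk : 2 ≤ k) (i : ℕ) (hik : i ≤ k) :
    (∃ f : ℕ → Op (Fin k), ∀ n : ℕ, ProperSubfn (B (Fin k) i) (f (n + 1)) (f n)) ↔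
      (2 ≤ i ∧ i ≤ k - 2) := by
  haveI : NeZero k := ⟨by omega⟩
  constructor
  · intro h
    by_contra hcon
    rcases i with _ | _ | i
    · exact case0 h
    · exact case1 (A := Fin k) 0 (by simpa using hk) h
    · refine big_case (A := Fin k) i (by rw [Nat.card_fin]; omega)
        ⟨⟨0, by omega⟩, ⟨1, by omega⟩, by simp [Fin.ext_iff]⟩ ?_ h
      by_cases hk3 : k ≤ i + 2
      · right; rw [Nat.card_fin]; exact hk3
      · left
        exact ⟨⟨0, by omega⟩, ⟨1, by omega⟩, ⟨2, by omega⟩, by simp [Fin.ext_iff],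
          by simp [Fin.ext_iff], by simp [Fin.ext_iff]⟩
  · rintro ⟨h2, hi⟩
    obtain ⟨i, rfl⟩ := Nat.exists_eq_add_of_le' h2
    exact ⟨fun n => ⟨n + 2 + 1, FF k (n + 2)⟩, fun n =>
      ⟨FF_sub hk i (n + 2) (by omega), FF_not_sub i (by omega) (n + 2) (by omega)⟩⟩

end PaperSubfn
end

section
/- Let A be a finite set with k ≥ 3 elements and let B_0 ⊂ B_1 ⊂ ⋯ ⊂ B_k be the chain of all clones on A containing all unary operations. For each 0 ≤ i ≤ k, there exists an infinite set of pairwise B_i-incomparable operations on A if and only if i ≤ k−2. -/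
namespace PaperSubfn

variable {A : Type*}

theorem eq_of_essSet {n : ℕ} (f : (Fin n → A) → A) (a b : Fin n → A)
    (h : ∀ i ∈ essSet f, a i = b i) : f a = f b := by
  classical
  have key : ∀ s : Finset (Fin n), f (fun i => if i ∈ s then b i else a i) = f a := by
    intro s
    induction s using Finset.induction_on with
    | empty => simp
    | insert j s hj ih =>
      rw [← ih]
      by_contra hne
      by_cases hje : j ∈ essSet f
      · apply hne
        congr 1
        funext i
        by_cases hij : i = j
        · subst hij
          simp [hj, h i hje]
        · simp [hij]
      · apply hje
        refine ⟨_, _, ?_, hne⟩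
        intro i hij
        simp [hij]
  have := key Finset.univ
  simpa using this.symm

theorem essUnary_factor {n : ℕ} (hn : 0 < n) (f : (Fin n → A) → A)
    (h : EssUnary (⟨n, f⟩ : Op A)) : ∃ i : Fin n, ∀ a b : Fin n → A, a i = b i → f a = f b := by
  by_cases he : (essSet f).Nonempty
  · obtain ⟨i, hi⟩ := he
    refine ⟨i, fun a b hab => eq_of_essSet f a b ?_⟩
    intro j hj
    have : j = i := h hj hi
    rw [this, hab]
  · refine ⟨⟨0, hn⟩, fun a b _ => eq_of_essSet f a b ?_⟩
    intro j hj
    exact absurd ⟨j, hj⟩ he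

theorem essUnary_comp {n : ℕ} (f : (Fin n → A) → A) (u : A → A)
    (h : EssUnary (⟨n, f⟩ : Op A)) : EssUnary (⟨n, fun a => u (f a)⟩ : Op A) := by
  have key : ∀ i, i ∈ essSet (fun a => u (f a)) → i ∈ essSet f := by
    rintro i ⟨a, b, hab, hne⟩
    exact ⟨a, b, hab, fun he => hne (by simp [he])⟩
  intro i hi j hj
  exact h (key i hi) (key j hj)

theorem essUnary_of_B0 (f : Op A) (h : f ∈ B A 0) : EssUnary f := by
  have hc : IsClone {f : Op A | EssUnary f} := by
    constructor
    · intro n i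
      have key : ∀ j, j ∈ essSet (proj A n i).2 → j = i := by
        rintro j ⟨a, b, hab, hne⟩
        by_contra hji
        exact hne (hab i (fun h => hji h.symm))
      intro j hj l hl
      rw [key j hj, key l hl]
    · intro n m f g hf hg
      rcases Nat.eq_zero_or_pos n with hn | hn
      · subst hn
        rintro i ⟨a, b, hab, hne⟩
        exact absurd (congrArg f (Subsingleton.elim _ _)) hne
      · obtain ⟨p, hp⟩ := essUnary_factor hn f hf
        have key : ∀ i, i ∈ essSet (fun a => f fun i => g i a) → i ∈ essSet (g p) := by
          rintro i ⟨a, b, hab, hne⟩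
          exact ⟨a, b, hab, fun he => hne (hp _ _ he)⟩
        intro i hi j hj
        exact hg p (key i hi) (key j hj)
  have hu : unaries A ⊆ {f : Op A | EssUnary f} := by
    rintro ⟨n, f⟩ (hf : n = 1)
    subst hf
    intro i _ j _
    exact Subsingleton.elim _ _
  exact h _ ⟨hc, hu⟩

theorem three_points {X : Type*} [Fintype A] (hA : 3 ≤ Fintype.card A) (G : A → X → A)
    (hs : ∀ c, ∃ a x, G a x = c) (h1 : ∃ x a b, G a x ≠ G b x)
    (h2 : ∃ a x y, G a x ≠ G a y) :
    ∃ a b x y, G a x ≠ G b x ∧ G a x ≠ G a y ∧ G b x ≠ G a y := by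
  classical
  have third : ∀ u v : A, ∃ w, w ≠ u ∧ w ≠ v := by
    intro u v
    by_contra hcon
    push Not at hcon
    have hsub : (Finset.univ : Finset A) ⊆ {u, v} := by
      intro w _
      by_cases hw : w = u
      · simp [hw]
      · simp [hcon w hw]
    have := Finset.card_le_card hsub
    have h2 : ({u, v} : Finset A).card ≤ 2 := Finset.card_le_two
    rw [Finset.card_univ] at this
    omega
  by_cases hc : ∃ x, (∃ a b, G a x ≠ G b x) ∧ ∃ c, ∀ a, G a x ≠ c
  · obtain ⟨x, ⟨a, b, hab⟩, c, hcx⟩ := hc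
    obtain ⟨p, y, hp⟩ := hs c
    by_cases hpa : G p x = G a x
    · exact ⟨p, b, x, y, by rw [hpa]; exact hab, by rw [hp]; exact hcx p,
        by rw [hp]; exact hcx b⟩
    · exact ⟨p, a, x, y, hpa, by rw [hp]; exact hcx p, by rw [hp]; exact hcx a⟩
  · push Not at hc
    have fin : ∀ a x y, G a x ≠ G a y → (∃ b c, G b x ≠ G c x) →
        ∃ a b x y, G a x ≠ G b x ∧ G a x ≠ G a y ∧ G b x ≠ G a y := by
      intro a x y hxy hx
      obtain ⟨w, hw1, hw2⟩ := third (G a x) (G a y)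
      obtain ⟨p, q, hpq⟩ := hx
      obtain ⟨b, hb⟩ := hc x ⟨p, q, hpq⟩ w
      exact ⟨a, b, x, y, by rw [hb]; exact hw1.symm, hxy, by rw [hb]; exact hw2⟩
    obtain ⟨x0, p, q, hpq⟩ := h1
    obtain ⟨a, x, y, hxy⟩ := h2
    by_cases hx : G a x0 = G a x
    · exact fin a x0 y (by rw [hx]; exact hxy) ⟨p, q, hpq⟩
    · exact fin a x0 x hx ⟨p, q, hpq⟩

theorem jablonski [Fintype A] (hA : 3 ≤ Fintype.card A) {m : ℕ} (g : (Fin m → A) → A)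
    (hs : Function.Surjective g) (hg : ¬ EssUnary (⟨m, g⟩ : Op A)) :
    ∃ s : A → Fin m → A, (∀ c, g (s c) = c) ∧ ∀ j, ∃ c c', c ≠ c' ∧ s c j = s c' j := by
  classical
  unfold EssUnary at hg
  rw [Set.not_subsingleton_iff] at hg
  obtain ⟨i, ⟨a, b, hab, hne⟩, i', ⟨a', b', hab', hne'⟩, hii⟩ := hg
  simp only at hne hne'
  obtain ⟨p, q, x, y, h1, h2, h3⟩ := three_points hA
    (fun (c : A) (x : Fin m → A) => g (Function.update x i c))
    (by
      intro c
      obtain ⟨x, hx⟩ := hs c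
      exact ⟨x i, x, by simpa using hx⟩)
    (by
      refine ⟨a, a i, b i, ?_⟩
      have : Function.update a i (b i) = b := by
        funext j
        by_cases hj : j = i
        · subst hj; simp
        · simp [hj, hab j hj]
      simpa [this] using hne)
    (by
      refine ⟨a' i, a', b', ?_⟩
      have : Function.update b' i (a' i) = b' := by
        rw [hab' i hii, Function.update_eq_self]
      simpa [this] using hne')
  choose s0 hs0 using hs
  set P := Function.update x i p with hP
  set Q := Function.update x i q with hQ
  set R := Function.update y i p with hR
  let s : A → Fin m → A := fun c =>
    if c = g P then P else if c = g Q then Q else if c = g R then R else s0 c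
  have sP : s (g P) = P := by simp [s]
  have sQ : s (g Q) = Q := by simp [s, h1.symm]
  have sR : s (g R) = R := by simp [s, h2.symm, h3.symm]
  refine ⟨s, ?_, ?_⟩
  · intro c
    by_cases c1 : c = g P
    · rw [c1, sP]
    by_cases c2 : c = g Q
    · rw [c2, sQ]
    by_cases c3 : c = g R
    · rw [c3, sR]
    simp [s, c1, c2, c3, hs0]
  · intro j
    by_cases hj : j = i
    · refine ⟨g P, g R, h2, ?_⟩
      rw [sP, sR, hP, hR, hj]; simp
    · refine ⟨g P, g Q, h1, ?_⟩
      rw [sP, sQ, hP, hQ]; simp [hj]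

theorem subfn_of_same [Fintype A] (hA : 3 ≤ Fintype.card A) (i : ℕ)
    (hi : Fintype.card A - 1 ≤ i) (f g : Op A) (hr : rng f = rng g)
    (he : EssUnary f ↔ EssUnary g) : Subfn (B A i) f g := by
  classical
  obtain ⟨n, f⟩ := f
  obtain ⟨m, g⟩ := g
  obtain ⟨i, rfl⟩ : ∃ l, i = l + 2 := ⟨i - 2, by omega⟩
  have hsec : ∃ s : A → Fin m → A, ∀ a, g (s (f a)) = f a := by
    have : ∀ c, ∃ x : Fin m → A, c ∈ Set.range f → g x = c := by
      intro c
      by_cases hc : c ∈ Set.range f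
      · have hc' : c ∈ rng (⟨m, g⟩ : Op A) := by rw [← hr]; exact hc
        obtain ⟨x, hx⟩ := hc'
        exact ⟨x, fun _ => hx⟩
      · exact ⟨fun _ => c, fun h => absurd h hc⟩
    choose s hs using this
    exact ⟨s, fun a => hs _ ⟨a, rfl⟩⟩
  by_cases hf : EssUnary (⟨n, f⟩ : Op A)
  · obtain ⟨s, hs⟩ := hsec
    refine ⟨fun j a => s (f a) j, fun j => Or.inl (essUnary_comp f (fun c => s c j) hf), ?_⟩
    intro a
    exact (hs a).symm
  by_cases hu : rng (⟨n, f⟩ : Op A) = Set.univ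
  · have hg : ¬ EssUnary (⟨m, g⟩ : Op A) := fun h => hf (he.2 h)
    have hsg : Function.Surjective g := by
      rw [hr] at hu
      exact Set.range_eq_univ.1 hu
    obtain ⟨s, hs, hinj⟩ := jablonski hA g hsg hg
    refine ⟨fun j a => s (f a) j, fun j => Or.inr ?_, fun a => (hs (f a)).symm⟩
    have hsub : rng (⟨n, fun a => s (f a) j⟩ : Op A) ⊆ Set.range (fun c => s c j) := by
      rintro _ ⟨a, rfl⟩
      exact ⟨f a, rfl⟩
    obtain ⟨c, c', hcc, hcs⟩ := hinj j
    have hlt : (Set.range (fun c => s c j)).ncard ≤ Fintype.card A - 1 := by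
      have : Set.range (fun c => s c j) ⊆ (fun c => s c j) '' {d | d ≠ c} := by
        rintro _ ⟨d, rfl⟩
        by_cases hd : d = c
        · exact ⟨c', hcc.symm, by simp [hd, hcs]⟩
        · exact ⟨d, hd, rfl⟩
      refine (Set.ncard_le_ncard this (Set.toFinite _)).trans
        ((Set.ncard_image_le (Set.toFinite _)).trans ?_)
      have : ({d | d ≠ c} : Set A) = {c}ᶜ := rfl
      rw [this, Set.ncard_compl, Set.ncard_singleton, Nat.card_eq_fintype_card]
    exact (Set.ncard_le_ncard hsub (Set.toFinite _)).trans (hlt.trans hi)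
  · obtain ⟨s, hs⟩ := hsec
    refine ⟨fun j a => s (f a) j, fun j => Or.inr ?_, fun a => (hs a).symm⟩
    have hsub : rng (⟨n, fun a => s (f a) j⟩ : Op A) ⊆
        (fun c => s c j) '' rng (⟨n, f⟩ : Op A) := by
      rintro _ ⟨a, rfl⟩
      exact ⟨f a, ⟨a, rfl⟩, rfl⟩
    have hlt : (rng (⟨n, f⟩ : Op A)).ncard < Fintype.card A := by
      rw [← Nat.card_eq_fintype_card, ← Set.ncard_univ]
      exact Set.ncard_lt_ncard (Set.ssubset_univ_iff.2 hu) (Set.toFinite _)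
    have := (Set.ncard_le_ncard hsub (Set.toFinite _)).trans
      (Set.ncard_image_le (Set.toFinite _))
    show (rng (⟨n, fun a => s (f a) j⟩ : Op A)).ncard ≤ i + 2
    omega

theorem no_antichain [Fintype A] (hA : 3 ≤ Fintype.card A) (i : ℕ)
    (hi : Fintype.card A - 1 ≤ i) (S : Set (Op A)) (hS : S.Infinite)
    (hp : S.Pairwise (Incomp (B A i))) : False := by
  classical
  obtain ⟨f, hf, g, hg, hne, heq⟩ := hS.exists_ne_map_eq_of_mapsTo
    (f := fun f : Op A => (rng f, EssUnary f)) (t := Set.univ)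
    (fun _ _ => Set.mem_univ _) (Set.toFinite _)
  simp only [Prod.mk.injEq] at heq
  exact (hp hf hg hne).1 (subfn_of_same hA i hi f g heq.1 (by rw [heq.2]))

theorem comb {n m : ℕ} (hn : 4 ≤ n) (σ : Fin m → Fin n) (v w : Fin m → Prop)
    [DecidablePred v] [DecidablePred w]
    (h1 : ∀ i, (Finset.univ.filter fun j => if σ j = i then w j else v j).card = 1 ∨
      (∀ j, if σ j = i then w j else v j))
    (h2 : (Finset.univ.filter fun j => w j).card = 1 ∨ ∀ j, w j)
    (h3 : (Finset.univ.filter fun j => v j).card ≠ 1) (h4 : ¬ ∀ j, v j) : n = m := by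
  classical
  by_cases hv : ∃ j, v j
  · exfalso
    obtain ⟨p, hp⟩ := hv
    obtain ⟨q, hq, hqp⟩ : ∃ q, v q ∧ q ≠ p := by
      by_contra hcon
      push Not at hcon
      apply h3
      rw [Finset.card_eq_one]
      refine ⟨p, ?_⟩
      ext j
      simp only [Finset.mem_filter, Finset.mem_univ, true_and, Finset.mem_singleton]
      exact ⟨hcon j, fun h => h ▸ hp⟩
    push Not at h4
    obtain ⟨r, hr⟩ := h4
    have : ∃ i : Fin n, i ∉ ({σ p, σ q, σ r} : Finset (Fin n)) := by
      by_contra hcon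
      push Not at hcon
      have hc := Finset.card_le_card (fun i _ => hcon i : (Finset.univ : Finset (Fin n)) ⊆ _)
      have := Finset.card_le_three (a := σ p) (b := σ q) (c := σ r)
      rw [Finset.card_univ, Fintype.card_fin] at hc
      omega
    obtain ⟨i, hi⟩ := this
    simp only [Finset.mem_insert, Finset.mem_singleton, not_or] at hi
    rcases h1 i with h | h
    · rw [Finset.card_eq_one] at h
      obtain ⟨a, ha⟩ := h
      have hpa : p ∈ ({a} : Finset (Fin m)) := by
        rw [← ha]; simp [Ne.symm hi.1, hp]
      have hqa : q ∈ ({a} : Finset (Fin m)) := by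
        rw [← ha]; simp [Ne.symm hi.2.1, hq]
      simp only [Finset.mem_singleton] at hpa hqa
      exact hqp (hqa.trans hpa.symm)
    · have := h r
      rw [if_neg (Ne.symm hi.2.2)] at this
      exact hr this
  · push Not at hv
    have hcard : ∀ i, ∃ j, σ j = i ∧ w j := by
      intro i
      rcases h1 i with h | h
      · rw [Finset.card_eq_one] at h
        obtain ⟨a, ha⟩ := h
        have haa : a ∈ ({a} : Finset (Fin m)) := by simp
        rw [← ha] at haa
        simp only [Finset.mem_filter, Finset.mem_univ, true_and] at haa
        by_cases hs : σ a = i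
        · rw [if_pos hs] at haa
          exact ⟨a, hs, haa⟩
        · rw [if_neg hs] at haa
          exact absurd haa (hv a)
      · have hm : ∃ j : Fin m, True := by
          by_contra hcon
          push Not at hcon
          exact h4 fun j => (hcon j).elim
        obtain ⟨a, -⟩ := hm
        have haa := h a
        by_cases hs : σ a = i
        · rw [if_pos hs] at haa
          exact ⟨a, hs, haa⟩
        · rw [if_neg hs] at haa
          exact absurd haa (hv a)
    choose d hd hw using hcard
    have dinj : Function.Injective d := by
      intro i j hij
      rw [← hd i, ← hd j, hij]
    have i01 : (⟨0, by omega⟩ : Fin n) ≠ ⟨1, by omega⟩ := by simp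
    have hwall : ∀ j, w j := by
      rcases h2 with h | h
      · exfalso
        rw [Finset.card_eq_one] at h
        obtain ⟨a, ha⟩ := h
        have key : ∀ i, d i = a := by
          intro i
          have : d i ∈ ({a} : Finset (Fin m)) := by rw [← ha]; simp [hw i]
          simpa using this
        exact i01 (dinj ((key _).trans (key _).symm))
      · exact h
    have dsurj : Function.Surjective d := by
      intro j
      refine ⟨σ j, ?_⟩
      rcases h1 (σ j) with h | h
      · rw [Finset.card_eq_one] at h
        obtain ⟨a, ha⟩ := h
        have m1 : j ∈ ({a} : Finset (Fin m)) := by rw [← ha]; simp [hwall j]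
        have m2 : d (σ j) ∈ ({a} : Finset (Fin m)) := by rw [← ha]; simp [hd, hwall]
        simp only [Finset.mem_singleton] at m1 m2
        rw [m1, ← m2, hd, m2]
      · exfalso
        have key : ∀ i, i = σ j := by
          intro i
          by_contra hne
          have := h (d i)
          rw [hd i, if_neg hne] at this
          exact hv _ this
        exact i01 ((key _).trans (key _).symm)
    have := Fintype.card_of_bijective ⟨dinj, dsurj⟩
    simpa using this

open Classical in
/-- The operations of the antichain. -/
noncomputable def F (o t : A) (n : ℕ) : (Fin n → A) → A := fun x =>
  if h : ∃ c, ∀ j, x j = c then h.choose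
  else if (∃ i, x = Function.update (fun _ => t) i o) then o else t

theorem F_const {o t : A} {n : ℕ} (hn : 0 < n) (c : A) : F o t n (fun _ => c) = c := by
  have h : ∃ d : A, ∀ j : Fin n, (fun _ : Fin n => c) j = d := ⟨c, fun _ => rfl⟩
  unfold F
  rw [dif_pos h]
  exact (h.choose_spec ⟨0, hn⟩).symm

theorem F_eq_other {o t : A} {n : ℕ} (c : A) (ho : c ≠ o) (ht : c ≠ t)
    (x : Fin n → A) (hx : F o t n x = c) : ∀ j, x j = c := by
  unfold F at hx
  split_ifs at hx with h1 h2
  · intro j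
    rw [← hx]
    exact h1.choose_spec j
  · exact absurd hx.symm ho
  · exact absurd hx.symm ht

theorem F_upd {o t : A} (hot : o ≠ t) {n : ℕ} (hn : 2 ≤ n) (i : Fin n) :
    F o t n (Function.update (fun _ => t) i o) = o := by
  have h : ¬ ∃ d : A, ∀ j : Fin n, Function.update (fun _ => t) i o j = d := by
    rintro ⟨d, hd⟩
    have h1 := hd i
    rw [Function.update_self] at h1
    have : ∃ j : Fin n, j ≠ i := by
      have : Nontrivial (Fin n) := Fin.nontrivial_iff_two_le.2 hn
      exact exists_ne i
    obtain ⟨j, hj⟩ := this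
    have h2 := hd j
    rw [Function.update_of_ne hj] at h2
    exact hot (h1.trans h2.symm)
  unfold F
  rw [dif_neg h, if_pos ⟨i, rfl⟩]

theorem F_eq_o {o t : A} {n : ℕ} (hot : o ≠ t) (x : Fin n → A) (hx : F o t n x = o) :
    (∀ j, x j = o) ∨ ∃ i, x = Function.update (fun _ => t) i o := by
  unfold F at hx
  split_ifs at hx with h1 h2
  · left
    intro j
    rw [← hx]
    exact h1.choose_spec j
  · exact Or.inr h2
  · exact absurd hx.symm hot

theorem F_o_val {o t : A} {n : ℕ} (hot : o ≠ t) (x : Fin n → A) (hx : F o t n x = o) (j : Fin n) :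
    x j = o ∨ x j = t := by
  rcases F_eq_o hot x hx with h | ⟨i, h⟩
  · exact Or.inl (h j)
  · rw [h]
    by_cases hj : j = i
    · subst hj; simp
    · simp [hj]

open Classical in
theorem F_o_count {o t : A} {n : ℕ} (hot : o ≠ t) (x : Fin n → A) (hx : F o t n x = o) :
    (Finset.univ.filter fun j => x j = o).card = 1 ∨ ∀ j, x j = o := by
  rcases F_eq_o hot x hx with h | ⟨i, h⟩
  · exact Or.inr h
  · left
    rw [Finset.card_eq_one]
    refine ⟨i, ?_⟩
    ext j
    by_cases hj : j = i
    · subst hj; simp [h]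
    · simp [h, hj, hot.symm]

theorem coord [Fintype A] {z o t : A} (hot : o ≠ t) (hzo : z ≠ o) (hzt : z ≠ t)
    {n : ℕ} (hn : 4 ≤ n) (hev : Even n) (i : ℕ) (hi : i + 2 ≤ Fintype.card A)
    (h : (Fin n → A) → A) (hB : (⟨n, h⟩ : Op A) ∈ B A i)
    (hc : ∀ c, c ≠ o → c ≠ t → h (fun _ => c) = c)
    (he : ∀ l, h (Function.update (fun _ => t) l o) = o ∨
      h (Function.update (fun _ => t) l o) = t)
    (h1 : h (fun _ => o) = o ∨ h (fun _ => o) = t) :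
    ∃ s : Fin n, (∀ l, l ≠ s → h (Function.update (fun _ => t) l o) = h (fun _ => t)) ∧
      h (fun _ => o) = h (Function.update (fun _ => t) s o) := by
  classical
  have hcase : EssUnary (⟨n, h⟩ : Op A) ∨ Quasilinear (⟨n, h⟩ : Op A) := by
    match i, hi, hB with
    | 0, _, hB => exact Or.inl (essUnary_of_B0 _ hB)
    | 1, _, hB => exact hB
    | i + 2, hi, hB =>
      rcases hB with hB | hB
      · exact Or.inl hB
      · exfalso
        obtain ⟨e, he'⟩ : ∃ e : A, ({e}ᶜ : Set A) ⊆ rng (⟨n, h⟩ : Op A) := by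
          rcases h1 with h1 | h1
          · refine ⟨t, fun c hct => ?_⟩
            by_cases hco : c = o
            · exact ⟨fun _ => o, by rw [hco]; exact h1⟩
            · exact ⟨fun _ => c, hc c hco hct⟩
          · refine ⟨o, fun c hco => ?_⟩
            by_cases hct : c = t
            · exact ⟨fun _ => o, by rw [hct]; exact h1⟩
            · exact ⟨fun _ => c, hc c hco hct⟩
        have := Set.ncard_le_ncard he' (Set.toFinite _)
        rw [Set.ncard_compl, Set.ncard_singleton, Nat.card_eq_fintype_card] at this
        omega
  rcases hcase with hU | hQ
  · obtain ⟨s, hs⟩ := essUnary_factor (by omega) h hU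
    refine ⟨s, fun l hl => hs _ _ ?_, hs _ _ ?_⟩
    · rw [Function.update_of_ne hl.symm]
    · rw [Function.update_self]
  · obtain ⟨α, g, hα⟩ := hQ
    simp only at α hα
    have hz := hc z hzo hzt
    rw [hα] at hz
    set c0 : ZMod 2 := ∑ i, α i z with hc0
    have two : ∀ c : ZMod 2, g c ≠ z → c = c0 + 1 := by
      intro c hcz
      have : c ≠ c0 := fun h => hcz (h ▸ hz)
      exact (by decide : ∀ c d : ZMod 2, c ≠ d → c = d + 1) c c0 this
    have sumupd : ∀ l, ∑ i, α i (Function.update (fun _ => t) l o i) =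
        ∑ i, α i t + (α l o - α l t) := by
      intro l
      have : ∀ i, α i (Function.update (fun _ => t) l o i) =
          α i t + (if i = l then α l o - α l t else 0) := by
        intro i
        by_cases hil : i = l
        · subst hil; simp
        · simp [hil]
      simp [this, Finset.sum_add_distrib]
    have e1 : ∀ l, ∑ i, α i t + (α l o - α l t) = c0 + 1 := by
      intro l
      rw [← sumupd]
      apply two
      have := he l
      rw [hα] at this
      rcases this with h | h <;> rw [h]
      · exact hzo.symm
      · exact hzt.symm
    have e2 : ∑ i, α i o = c0 + 1 := by
      apply two
      have := h1
      rw [hα] at this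
      rcases this with h | h <;> rw [h]
      · exact hzo.symm
      · exact hzt.symm
    have e3 : ∑ i, α i t = c0 + 1 := by
      have hd : ∀ l, α l o = α l t + (c0 + 1 - ∑ i, α i t) := by
        intro l
        rw [← e1 l]; ring
      have : ∑ i, α i o = ∑ i, α i t + (n : ZMod 2) * (c0 + 1 - ∑ i, α i t) := by
        rw [Finset.sum_congr rfl (fun l _ => hd l), Finset.sum_add_distrib]
        simp only [Finset.sum_const, Finset.card_univ, Fintype.card_fin, nsmul_eq_mul]
      rw [(ZMod.natCast_eq_zero_iff_even).2 hev] at this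
      rw [← e2, this]; ring
    have vt : h (fun _ => t) = g (c0 + 1) := by rw [hα, e3]
    have vo : h (fun _ => o) = g (c0 + 1) := by rw [hα, e2]
    have ve : ∀ l, h (Function.update (fun _ => t) l o) = g (c0 + 1) := by
      intro l; rw [hα, sumupd, e1]
    exact ⟨⟨0, by omega⟩, fun l _ => by rw [ve, vt], by rw [vo, ve]⟩

theorem F_anti [Fintype A] {z o t : A} (hot : o ≠ t) (hzo : z ≠ o) (hzt : z ≠ t)
    {n m : ℕ} (hn : 4 ≤ n) (hm : 4 ≤ m) (hev : Even n) (i : ℕ) (hi : i + 2 ≤ Fintype.card A)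
    (hsub : Subfn (B A i) ⟨n, F o t n⟩ ⟨m, F o t m⟩) : n = m := by
  classical
  obtain ⟨h, hB, hF⟩ := hsub
  simp only at h hB hF
  have ve : ∀ l, F o t m (fun j => h j (Function.update (fun _ => t) l o)) = o := by
    intro l; rw [← hF, F_upd hot (by omega)]
  have vo : F o t m (fun j => h j (fun _ => o)) = o := by
    rw [← hF, F_const (by omega)]
  have vt : F o t m (fun j => h j (fun _ => t)) = t := by
    rw [← hF, F_const (by omega)]
  have key := fun j => coord hot hzo hzt hn hev i hi (h j) (hB j)
    (fun c hco hct => F_eq_other c hco hct (fun j => h j (fun _ => c))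
      (by rw [← hF, F_const (by omega)]) j)
    (fun l => F_o_val hot _ (ve l) j) (F_o_val hot _ vo j)
  choose σ hσ1 hσ2 using key
  have pat : ∀ l j, h j (Function.update (fun _ => t) l o) = o ↔
      (if σ j = l then h j (fun _ => o) = o else h j (fun _ => t) = o) := by
    intro l j
    by_cases hl : σ j = l
    · rw [if_pos hl, hσ2 j, hl]
    · rw [if_neg hl, hσ1 j l (Ne.symm hl)]
  have tval : ∀ j, h j (fun _ => t) = o ∨ h j (fun _ => t) = t := by
    intro j
    have : Nontrivial (Fin n) := Fin.nontrivial_iff_two_le.2 (by omega)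
    obtain ⟨l, hl⟩ := exists_ne (σ j)
    rw [← hσ1 j l hl]
    exact F_o_val hot _ (ve l) j
  refine comb hn σ (fun j => h j (fun _ => t) = o) (fun j => h j (fun _ => o) = o) ?_ ?_ ?_ ?_
  · intro l
    have := F_o_count hot _ (ve l)
    simp only [pat] at this
    convert this
  · have := F_o_count hot _ vo
    convert this
  · intro hcard
    rw [Finset.card_eq_one] at hcard
    obtain ⟨a, ha⟩ := hcard
    have : (fun j => h j (fun _ => t)) = Function.update (fun _ => t) a o := by
      funext j
      have hj : h j (fun _ => t) = o ↔ j = a := by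
        have := Finset.ext_iff.1 ha j
        simpa using this
      by_cases hja : j = a
      · rw [hj.2 hja, hja, Function.update_self]
      · rw [Function.update_of_ne hja]
        exact (tval j).resolve_left (fun h => hja (hj.1 h))
    rw [this, F_upd hot (by omega)] at vt
    exact hot vt
  · intro hall
    have : (fun j => h j (fun _ => t)) = fun _ => o := funext hall
    rw [this, F_const (by omega)] at vt
    exact hot vt

/-- Main theorem, part (ii): for a `k`-element base set with `k ≥ 3`, there is an
infinite antichain of pairwise `B_i`-incomparable operations iff `i ≤ k - 2`. -/
theorem infinite_antichain_iff (k : ℕ) (hk : 3 ≤ k) (i : ℕ) (hik : i ≤ k) :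
    (∃ S : Set (Op (Fin k)), S.Infinite ∧ S.Pairwise (Incomp (B (Fin k) i))) ↔
      i ≤ k - 2 := by
  constructor
  · rintro ⟨S, hS, hp⟩
    by_contra hcon
    exact no_antichain (by simpa using hk) i (by rw [Fintype.card_fin]; omega) S hS hp
  · intro hi
    let z : Fin k := ⟨0, by omega⟩
    let o : Fin k := ⟨1, by omega⟩
    let t : Fin k := ⟨2, by omega⟩
    have hot : o ≠ t := by simp [o, t]
    have hzo : z ≠ o := by simp [z, o]
    have hzt : z ≠ t := by simp [z, t]
    refine ⟨Set.range fun l : ℕ => (⟨2 * l + 4, F o t (2 * l + 4)⟩ : Op (Fin k)), ?_, ?_⟩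
    · apply Set.infinite_range_of_injective
      intro a b hab
      have := congrArg Sigma.fst hab
      simp only at this
      omega
    · rintro _ ⟨a, rfl⟩ _ ⟨b, rfl⟩ hne
      have hab : a ≠ b := fun h => hne (by rw [h])
      have hc : i + 2 ≤ Fintype.card (Fin k) := by rw [Fintype.card_fin]; omega
      constructor
      · intro hs
        have := F_anti hot hzo hzt (by omega) (by omega) ⟨a + 2, by ring⟩ i hc hs
        omega
      · intro hs
        have := F_anti hot hzo hzt (by omega) (by omega) ⟨b + 2, by ring⟩ i hc hs
        omega

end PaperSubfn
end

section
/- Let A be a finite set and let C be a clone on A containing all unary operations on A. Then for every nonempty subset S of A, the set C_S = {f ∈ C : range f = S}, if nonempty, is a full equivalence class of the relation ≡_C: any two members of C_S are C-equivalent, and every operation C-equivalent to a member of C_S belongs to C_S. -/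
namespace PaperSubfn

variable {A : Type*}

theorem subfn_aux {A : Type*} (C : Set (Op A)) (hC : IsClone C)
    (hU : unaries A ⊆ C) (f g : Op A) (hf : f ∈ C) (h : rng f ⊆ rng g)
    (hn : (rng g).Nonempty) : Subfn C f g := by
  classical
  obtain ⟨_, x0, _⟩ := hn
  have hd : ∀ s : A, ∃ x : Fin g.1 → A, s ∈ rng g → g.2 x = s := by
    intro s
    by_cases hs : s ∈ rng g
    · obtain ⟨x, hx⟩ := hs
      exact ⟨x, fun _ => hx⟩
    · exact ⟨x0, fun h => absurd h hs⟩
  choose d hd using hd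
  refine ⟨fun i a => d (f.2 a) i, fun i => ?_, fun a => (hd _ (h ⟨a, rfl⟩)).symm⟩
  exact hC.2 1 f.1 (fun b => d (b 0) i) (fun _ => f.2) (hU rfl) (fun _ => hf)

theorem rng_aux {A : Type*} (C : Set (Op A)) (f g : Op A) (h : Subfn C f g) :
    rng f ⊆ rng g := by
  obtain ⟨k, _, hk⟩ := h
  rintro _ ⟨a, rfl⟩
  exact ⟨_, (hk a).symm⟩

/-- For a clone `C` containing all unary operations on a finite set and a nonempty
`S ⊆ A`, the set `C_S = {f ∈ C : range f = S}`, if nonempty, is a full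
`≡_C`-equivalence class. -/
theorem cS_is_equivClass (A : Type*) [Finite A] (C : Set (Op A)) (hC : IsClone C)
    (hU : unaries A ⊆ C) (S : Set A) (hS : S.Nonempty)
    (hne : {f : Op A | f ∈ C ∧ rng f = S}.Nonempty) :
    (∀ f ∈ {f : Op A | f ∈ C ∧ rng f = S}, ∀ g ∈ {f : Op A | f ∈ C ∧ rng f = S},
      EquivC C f g) ∧
    (∀ f ∈ {f : Op A | f ∈ C ∧ rng f = S}, ∀ g : Op A, EquivC C g f →
      g ∈ {f : Op A | f ∈ C ∧ rng f = S}) := by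
  refine ⟨?_, ?_⟩
  · rintro f ⟨hf, hfS⟩ g ⟨hg, hgS⟩
    exact ⟨subfn_aux C hC hU f g hf (by rw [hfS, hgS]) (by rwa [hgS]),
      subfn_aux C hC hU g f hg (by rw [hfS, hgS]) (by rwa [hfS])⟩
  · rintro f ⟨hf, hfS⟩ g ⟨h1, h2⟩
    refine ⟨?_, ?_⟩
    · obtain ⟨k, hk, hk'⟩ := h1
      have h3 := hC.2 f.1 g.1 f.2 k hf hk
      have h4 : g = ⟨g.1, fun a => f.2 fun i => k i a⟩ := by
        obtain ⟨n, g⟩ := g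
        exact congrArg (Sigma.mk n) (funext hk')
      rw [h4]
      exact h3
    · rw [← hfS]
      exact (rng_aux C g f h1).antisymm (rng_aux C f g h2)

end PaperSubfn
end

section
/- Let A be a finite set with k ≥ 2 elements. For all operations f, g on A: f ⊑_{O_A} g if and only if range f ⊆ range g, and f ≡_{O_A} g if and only if range f = range g. Consequently, the quotient poset O_A/≡_{O_A} ordered by ⊑_{O_A} is isomorphic to the poset of nonempty subsets of A ordered by inclusion; its largest chain has k elements and its largest antichain has C(k, ⌊k/2⌋) elements. -/
namespace PaperSubfn

variable {A : Type*}

/-- The quotient of `O_A` by the relation of `C`-equivalence. -/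
def QuotC (C : Set (Op A)) := Quot (EquivC C)

/-- The order induced by the `C`-subfunction relation on the quotient. -/
def QOrd (C : Set (Op A)) : QuotC C → QuotC C → Prop :=
  fun q₁ q₂ => ∃ f g : Op A, Quot.mk (EquivC C) f = q₁ ∧ Quot.mk (EquivC C) g = q₂ ∧ Subfn C f g

theorem aux_sub {A : Type*} (f g : Op A) :
    Subfn (Set.univ : Set (Op A)) f g ↔ rng f ⊆ rng g := by
  constructor
  · rintro ⟨h, -, hh⟩ x ⟨a, rfl⟩
    exact ⟨_, (hh a).symm⟩
  · intro hs
    have : ∀ a, ∃ b, g.2 b = f.2 a := fun a => hs ⟨a, rfl⟩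
    choose b hb using this
    exact ⟨fun i a => b a i, fun _ => Set.mem_univ _, fun a => (hb a).symm⟩

theorem aux_eqv {A : Type*} (f g : Op A) :
    EquivC (Set.univ : Set (Op A)) f g ↔ rng f = rng g := by
  unfold EquivC
  rw [aux_sub, aux_sub]
  exact Set.Subset.antisymm_iff.symm

theorem aux_iso (k : ℕ) (hk : 2 ≤ k) :
    ∃ e : QuotC (Set.univ : Set (Op (Fin k))) ≃ {S : Set (Fin k) // S.Nonempty},
      ∀ q₁ q₂, QOrd (Set.univ : Set (Op (Fin k))) q₁ q₂ ↔ (e q₁).1 ⊆ (e q₂).1 := by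
  classical
  have hne : ∀ f : Op (Fin k), (rng f).Nonempty := fun f =>
    ⟨f.2 (fun _ => ⟨0, by omega⟩), _, rfl⟩
  let F : QuotC (Set.univ : Set (Op (Fin k))) → {S : Set (Fin k) // S.Nonempty} :=
    Quot.lift (fun f => ⟨rng f, hne f⟩) (fun f g h => Subtype.ext ((aux_eqv f g).1 h))
  have hF : Function.Bijective F := by
    constructor
    · rintro ⟨f⟩ ⟨g⟩ h
      exact Quot.sound ((aux_eqv f g).2 (congrArg Subtype.val h))
    · rintro ⟨S, s, hs⟩
      refine ⟨Quot.mk _ ⟨1, fun a => if a 0 ∈ S then a 0 else s⟩, Subtype.ext ?_⟩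
      show Set.range _ = S
      ext x
      constructor
      · rintro ⟨a, rfl⟩
        dsimp only
        split_ifs with h
        · exact h
        · exact hs
      · intro hx
        exact ⟨fun _ => x, by simp [hx]⟩
  refine ⟨Equiv.ofBijective F hF, ?_⟩
  intro q₁ q₂
  constructor
  · rintro ⟨f, g, rfl, rfl, h⟩
    exact (aux_sub f g).1 h
  · induction q₁ using Quot.ind with | mk f => ?_
    induction q₂ using Quot.ind with | mk g => ?_
    intro h
    exact ⟨f, g, rfl, rfl, (aux_sub f g).2 h⟩

/-- On a `k`-element set (`k ≥ 2`): `f ⊑_{O_A} g` iff `range f ⊆ range g`,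
`f ≡_{O_A} g` iff `range f = range g`; the quotient poset is isomorphic to the
poset of nonempty subsets of `A`, whose largest chain has `k` elements and whose
largest antichain has `C(k, ⌊k/2⌋)` elements. -/
theorem structure_of_OA_quotient (k : ℕ) (hk : 2 ≤ k) :
    (∀ f g : Op (Fin k), Subfn (Set.univ : Set (Op (Fin k))) f g ↔ rng f ⊆ rng g) ∧
    (∀ f g : Op (Fin k), EquivC (Set.univ : Set (Op (Fin k))) f g ↔ rng f = rng g) ∧
    (∃ e : QuotC (Set.univ : Set (Op (Fin k))) ≃ {S : Set (Fin k) // S.Nonempty},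
      ∀ q₁ q₂, QOrd (Set.univ : Set (Op (Fin k))) q₁ q₂ ↔ (e q₁).1 ⊆ (e q₂).1) ∧
    (∃ c : Finset (QuotC (Set.univ : Set (Op (Fin k)))),
      IsChain (QOrd (Set.univ : Set (Op (Fin k)))) ↑c ∧ c.card = k ∧
      ∀ c' : Finset (QuotC (Set.univ : Set (Op (Fin k)))),
        IsChain (QOrd (Set.univ : Set (Op (Fin k)))) ↑c' → c'.card ≤ k) ∧
    (∃ c : Finset (QuotC (Set.univ : Set (Op (Fin k)))),
      IsAntichain (QOrd (Set.univ : Set (Op (Fin k)))) ↑c ∧ c.card = Nat.choose k (k / 2) ∧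
      ∀ c' : Finset (QuotC (Set.univ : Set (Op (Fin k)))),
        IsAntichain (QOrd (Set.univ : Set (Op (Fin k)))) ↑c' → c'.card ≤ Nat.choose k (k / 2)) := by
  classical
  refine ⟨aux_sub, aux_eqv, aux_iso k hk, ?_, ?_⟩
  · obtain ⟨e, he⟩ := aux_iso k hk
    let G : Fin k → QuotC (Set.univ : Set (Op (Fin k))) :=
      fun j => e.symm ⟨Set.Iic j, ⟨j, le_refl j⟩⟩
    have hG : Function.Injective G := by
      intro i j h
      have := congrArg Subtype.val (e.symm.injective h)
      exact Set.Iic_injective this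
    refine ⟨Finset.univ.map ⟨G, hG⟩, ?_, by simp, ?_⟩
    · intro a ha b hb _
      simp only [Finset.coe_map, Function.Embedding.coeFn_mk, Finset.coe_univ, Set.image_univ,
        Set.mem_range] at ha hb
      obtain ⟨i, rfl⟩ := ha
      obtain ⟨j, rfl⟩ := hb
      rw [he, he]
      simp only [G, Equiv.apply_symm_apply, Set.Iic_subset_Iic]
      exact le_total i j
    · intro c' hc
      have : c'.card ≤ (Finset.Icc 1 k).card := by
        apply Finset.card_le_card_of_injOn (fun q => (e q).1.ncard)
        · intro q _
          simp only [Finset.coe_Icc, Set.mem_Icc]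
          refine ⟨(Set.ncard_pos (Set.toFinite _)).2 (e q).2, ?_⟩
          have := Set.ncard_le_ncard (Set.subset_univ (e q).1) (Set.toFinite _)
          simpa [Set.ncard_univ] using this
        · intro a ha b hb hab
          by_contra hn
          apply hn
          apply e.injective
          apply Subtype.ext
          rcases hc ha hb hn with h | h
          · exact Set.eq_of_subset_of_ncard_le ((he _ _).1 h) hab.ge (Set.toFinite _)
          · exact (Set.eq_of_subset_of_ncard_le ((he _ _).1 h) hab.le (Set.toFinite _)).symm
      simpa using this
  · obtain ⟨e, he⟩ := aux_iso k hk
    let P := Finset.powersetCard (k / 2) (Finset.univ : Finset (Fin k))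
    have hP : ∀ s ∈ P, s.card = k / 2 := fun s hs => (Finset.mem_powersetCard.1 hs).2
    have hP' : ∀ s ∈ P, (s : Set (Fin k)).Nonempty := fun s hs => by
      rw [Finset.coe_nonempty, ← Finset.card_pos, hP s hs]; omega
    let G : {s // s ∈ P} → QuotC (Set.univ : Set (Op (Fin k))) :=
      fun s => e.symm ⟨(s.1 : Set (Fin k)), hP' s.1 s.2⟩
    have hG : Function.Injective G := by
      intro i j h
      have := congrArg Subtype.val (e.symm.injective h)
      exact Subtype.ext (Finset.coe_injective this)
    refine ⟨P.attach.map ⟨G, hG⟩, ?_, by simp [P], ?_⟩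
    · intro a ha b hb hab h
      simp only [Finset.coe_map, Function.Embedding.coeFn_mk, Set.mem_image] at ha hb
      obtain ⟨i, -, rfl⟩ := ha
      obtain ⟨j, -, rfl⟩ := hb
      rw [he] at h
      simp only [G, Equiv.apply_symm_apply, Finset.coe_subset] at h
      apply hab
      congr 1
      exact Subtype.ext (Finset.eq_of_subset_of_card_le h (by rw [hP _ i.2, hP _ j.2]))
    · intro c' hc
      have hinj : Function.Injective (fun q => (e q).1.toFinset) := by
        intro a b h
        exact e.injective (Subtype.ext (Set.toFinset_inj.1 h))
      have hanti : IsAntichain (· ⊆ ·)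
          ((c'.map ⟨_, hinj⟩ : Finset (Finset (Fin k))) : Set (Finset (Fin k))) := by
        intro a ha b hb hab h
        simp only [Finset.coe_map, Function.Embedding.coeFn_mk, Set.mem_image] at ha hb
        obtain ⟨p, hp, rfl⟩ := ha
        obtain ⟨q, hq, rfl⟩ := hb
        refine hc hp hq (fun h' => hab (by rw [h'])) ((he _ _).2 ?_)
        exact Set.toFinset_subset_toFinset.1 h
      simpa using hanti.sperner

end PaperSubfn
end

section
/- Let f be an operation on a finite set A. If f has at least two essential variables and takes on more than two values, then f possesses an essential triple. Conversely, if f possesses an essential triple, then f has at least two essential variables and each value of f appears in an essential triple for f. -/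
namespace PaperSubfn

variable {A : Type*}

/-- `(α, β, γ)` is an essential triple for `f`. -/
def EssTriple (f : Op A) (α β γ : A) : Prop :=
  α ≠ β ∧ α ≠ γ ∧ β ≠ γ ∧
  ∃ (a b c : Fin f.1 → A) (i : Fin f.1),
    (∀ j, j ≠ i → a j = b j) ∧ a i = c i ∧
    f.2 a = α ∧ f.2 b = β ∧ f.2 c = γ

theorem walk {n : ℕ} (f : (Fin n → A) → A) (a c : Fin n → A) (h : f a ≠ f c) :
    ∃ j, a j ≠ c j ∧ essAt f j := by
  classical
  by_contra hno
  push Not at hno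
  have key : ∀ S : Finset (Fin n), f (fun j => if j ∈ S then c j else a j) = f a := by
    intro S
    induction S using Finset.induction_on with
    | empty => simp
    | insert k S hk ih =>
      rw [← ih]
      by_cases hak : a k = c k
      · congr 1
        funext j
        by_cases hj : j = k
        · subst hj; simp [hk, hak]
        · simp [hj]
      · by_contra hne
        exact hno k hak ⟨_, _, fun j hj => by simp [hj], hne⟩
  have := key Finset.univ
  simp at this
  exact h this.symm

theorem row_miss (f : Op A) (i : Fin f.1) (a c u : Fin f.1 → A) (hac : a i = c i)
    (hne : f.2 a ≠ f.2 c) (hu : ∀ t : Fin f.1 → A, t i = a i → f.2 t ≠ f.2 u) :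
    ∃ α γ : A, EssTriple f α (f.2 u) γ := by
  classical
  have ht : Function.update u i (a i) i = a i := by simp
  have hj : ∀ j, j ≠ i → Function.update u i (a i) j = u j := fun j hj => by simp [hj]
  generalize Function.update u i (a i) = t at ht hj
  by_cases h : f.2 t = f.2 a
  · exact ⟨f.2 t, f.2 c, hu t ht, by rw [h]; exact hne, (hu c hac.symm).symm,
      t, u, c, i, hj, ht.trans hac, rfl, rfl, rfl⟩
  · exact ⟨f.2 t, f.2 a, hu t ht, h, (hu a rfl).symm, t, u, a, i, hj, ht, rfl, rfl, rfl⟩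

/-- Mal'tsev's lemma: an operation with at least two essential variables taking
more than two values possesses an essential triple; conversely, an operation
possessing an essential triple has at least two essential variables and each of
its values appears in an essential triple. -/
theorem essential_triple_lemma (A : Type*) [Finite A] (f : Op A) :
    ((2 ≤ essArity f ∧ 2 < (rng f).ncard) → ∃ α β γ : A, EssTriple f α β γ) ∧
    ((∃ α β γ : A, EssTriple f α β γ) →
      2 ≤ essArity f ∧
      ∀ v ∈ rng f, ∃ α β γ : A, EssTriple f α β γ ∧ v ∈ ({α, β, γ} : Set A)) := by
  classical
  constructor
  · rintro ⟨h2, h3⟩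
    obtain ⟨i, hi, j, hj, hij⟩ := (Set.one_lt_ncard (Set.toFinite _)).1
      (show 1 < (essSet f.2).ncard from h2)
    obtain ⟨a, c, hac, hne⟩ := hj
    obtain ⟨p, q, hpq, hpqne⟩ := hi
    by_cases hall : ∀ u, ∃ t : Fin f.1 → A, t i = a i ∧ f.2 t = f.2 u
    · have ht : Function.update p i (a i) i = a i := by simp
      have htj : ∀ k, k ≠ i → Function.update p i (a i) k = p k := fun k hk => by simp [hk]
      generalize Function.update p i (a i) = t at ht htj
      have hb : ∃ b, (∀ k, k ≠ i → t k = b k) ∧ f.2 t ≠ f.2 b := by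
        by_cases h : f.2 t = f.2 p
        · exact ⟨q, fun k hk => (htj k hk).trans (hpq k hk), by rw [h]; exact hpqne⟩
        · exact ⟨p, htj, h⟩
      obtain ⟨b, hb, hbne⟩ := hb
      have hlt : ({f.2 t, f.2 b} : Set A).ncard < (rng f).ncard :=
        lt_of_le_of_lt (by rw [Set.ncard_pair hbne]) h3
      obtain ⟨v, ⟨u, rfl⟩, hv⟩ := Set.exists_mem_notMem_of_ncard_lt_ncard hlt
      simp only [Set.mem_insert_iff, Set.mem_singleton_iff, not_or] at hv
      obtain ⟨c', hc', hcu⟩ := hall u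
      exact ⟨_, _, _, hbne, Ne.symm hv.1, Ne.symm hv.2, t, b, c', i, hb,
        ht.trans hc'.symm, rfl, rfl, hcu⟩
    · push Not at hall
      obtain ⟨u, hu⟩ := hall
      obtain ⟨α, γ, h⟩ := row_miss f i a c u (hac i hij) hne hu
      exact ⟨_, _, _, h⟩
  · rintro ⟨α, β, γ, h1, h2, h3, a, b, c, i, hab, hac, rfl, rfl, rfl⟩
    constructor
    · obtain ⟨j, hj, hje⟩ := walk f.2 a c h2
      have : 1 < (essSet f.2).ncard := (Set.one_lt_ncard (Set.toFinite _)).2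
        ⟨i, ⟨a, b, hab, h1⟩, j, hje, fun h => hj (h ▸ hac)⟩
      exact this
    · rintro v ⟨u, rfl⟩
      by_cases hu : ∃ t : Fin f.1 → A, t i = a i ∧ f.2 t = f.2 u
      · obtain ⟨t, ht, htu⟩ := hu
        by_cases hua : f.2 u = f.2 a
        · exact ⟨_, _, _, ⟨h1, h2, h3, a, b, c, i, hab, hac, rfl, rfl, rfl⟩, by simp [hua]⟩
        by_cases hub : f.2 u = f.2 b
        · exact ⟨_, _, _, ⟨h1, h2, h3, a, b, c, i, hab, hac, rfl, rfl, rfl⟩, by simp [hub]⟩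
        exact ⟨_, _, f.2 u, ⟨h1, Ne.symm hua, Ne.symm hub, a, b, t, i, hab, ht.symm,
          rfl, rfl, htu⟩, by simp⟩
      · push Not at hu
        obtain ⟨α, γ, h⟩ := row_miss f i a c u hac h2 hu
        exact ⟨_, _, _, h, by simp⟩

end PaperSubfn
end

section
/- Let f be an n-ary operation on a finite set A with at least two essential variables and with |range f| = r ≥ 3. Then there is a transversal B of the kernel of f (a set B ⊆ Aⁿ containing exactly one element of each equivalence class of ker f) such that |pr_i B| < r for every 1 ≤ i ≤ n, where pr_i B = {b_i : (b₁,…,b_n) ∈ B} is the projection of B onto its i-th component. -/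
namespace PaperSubfn

variable {A : Type*}

theorem exists_triple {A : Type*} {n : ℕ} (f : (Fin n → A) → A) (i j : Fin n) (hij : i ≠ j)
    (hi : essAt f i) (hj : essAt f j) (h3 : ∀ x y : A, ∃ t, f t ≠ x ∧ f t ≠ y) :
    ∃ p q c : Fin n → A, (∀ k, k ≠ i → q k = p k) ∧ c i = p i ∧
      f q ≠ f p ∧ f c ≠ f p ∧ f c ≠ f q := by
  classical
  obtain ⟨a, b, hab, hne⟩ := hi
  obtain ⟨a', b', hab', hne'⟩ := hj
  have hx := hab' i hij
  by_cases h : ∃ t, ∀ c : Fin n → A, c i = a' i → f c ≠ f t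
  · obtain ⟨t, ht⟩ := h
    have hp : (Function.update t i (a' i)) i = a' i := by simp
    have key : ∀ c : Fin n → A, c i = a' i → f c ≠ f (Function.update t i (a' i)) →
        ∃ p q c : Fin n → A, (∀ k, k ≠ i → q k = p k) ∧ c i = p i ∧
          f q ≠ f p ∧ f c ≠ f p ∧ f c ≠ f q := fun c hc hc' =>
      ⟨Function.update t i (a' i), t, c, fun k hk => by simp [hk], by simp [hc],
        (ht _ hp).symm, hc', ht c hc⟩
    by_cases h1 : f a' = f (Function.update t i (a' i))
    · exact key b' hx.symm (fun h2 => hne' (h1.trans h2.symm))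
    · exact key a' rfl h1
  · push Not at h
    have key : ∀ q : Fin n → A, (∀ k, k ≠ i → q k = a k) →
        f q ≠ f (Function.update a i (a' i)) →
        ∃ p q c : Fin n → A, (∀ k, k ≠ i → q k = p k) ∧ c i = p i ∧
          f q ≠ f p ∧ f c ≠ f p ∧ f c ≠ f q := fun q hq hq' => by
      obtain ⟨t, ht1, ht2⟩ := h3 (f (Function.update a i (a' i))) (f q)
      obtain ⟨c, hc, hct⟩ := h t
      exact ⟨Function.update a i (a' i), q, c, fun k hk => by simp [hk, hq k hk], by simp [hc],
        hq', hct ▸ ht1, hct ▸ ht2⟩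
    by_cases h1 : f a = f (Function.update a i (a' i))
    · exact key b (fun k hk => (hab k hk).symm) (fun h2 => hne (h1.trans h2.symm))
    · exact key a (fun _ _ => rfl) h1

/-- An operation with at least two essential variables and range of size `r ≥ 3`
admits a transversal `B` of its kernel all of whose coordinate projections have
fewer than `r` elements. -/
theorem exists_transversal_small_projections (A : Type*) [Finite A] (f : Op A)
    (r : ℕ) (h2 : 2 ≤ essArity f) (hr : (rng f).ncard = r) (hr3 : 3 ≤ r) :
    ∃ B : Set (Fin f.1 → A),
      (∀ a : Fin f.1 → A, ∃! b, b ∈ B ∧ f.2 b = f.2 a) ∧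
      ∀ i : Fin f.1, ((fun b : Fin f.1 → A => b i) '' B).ncard < r := by
  classical
  obtain ⟨i, j, hi, hj, hij⟩ := (Set.one_lt_ncard_iff (Set.toFinite _)).1
    (show 1 < (essSet f.2).ncard from h2)
  have h3 : ∀ x y : A, ∃ t, f.2 t ≠ x ∧ f.2 t ≠ y := by
    intro x y
    by_contra! hc
    have hsub : rng f ⊆ {x, y} := by
      rintro _ ⟨t, rfl⟩
      by_cases hx : f.2 t = x
      · exact Or.inl hx
      · exact Or.inr (hc t hx)
    have h1 := Set.ncard_le_ncard hsub (Set.toFinite _)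
    have h4 := Set.ncard_insert_le x {y}
    rw [Set.ncard_singleton] at h4
    omega
  obtain ⟨p, q, c, hqp, hcp, n1, n2, n3⟩ := exists_triple f.2 i j hij hi hj h3
  have hs : ∃ s : A → (Fin f.1 → A), (∀ v ∈ rng f, f.2 (s v) = v) ∧
      s (f.2 p) = p ∧ s (f.2 q) = q ∧ s (f.2 c) = c := by
    refine ⟨fun v => if v = f.2 p then p else if v = f.2 q then q else if v = f.2 c then c
      else if h : v ∈ rng f then h.choose else p, ?_, ?_, ?_, ?_⟩
    · intro v hv
      have := hv.choose_spec
      dsimp only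
      split_ifs <;> simp_all
    · simp
    · simp [n1]
    · simp [n2, n3]
  obtain ⟨s, hs, sp, sq, sc⟩ := hs
  refine ⟨s '' rng f, ?_, ?_⟩
  · intro a
    refine ⟨s (f.2 a), ⟨⟨_, ⟨a, rfl⟩, rfl⟩, hs _ ⟨a, rfl⟩⟩, ?_⟩
    rintro _ ⟨⟨v, hv, rfl⟩, h⟩
    rw [hs v hv] at h
    rw [h]
  · intro k
    rw [Set.image_image, ← hr]
    refine lt_of_le_of_ne (Set.ncard_image_le (Set.toFinite _)) fun he => ?_
    have hinj := Set.injOn_of_ncard_image_eq he (Set.toFinite _)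
    by_cases hk : k = i
    · subst hk
      exact n2 (hinj ⟨c, rfl⟩ ⟨p, rfl⟩ (by simp only [sc, sp, hcp]))
    · exact n1 (hinj ⟨q, rfl⟩ ⟨p, rfl⟩ (by simp only [sq, sp, hqp k hk]))


end PaperSubfn
end

section
/- Let A be a finite set with k ≥ 4 elements and let 2 ≤ p ≤ k−2. Then there is an infinite descending chain of B_p-subfunctions: an infinite sequence (f_n) of operations on A such that f_{n+1} is a proper B_p-subfunction of f_n for every n. -/
namespace PaperSubfn

variable {A : Type*}

/-- The operations of the chain, with `n + 1` variables. -/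
noncomputable def chainOp (m q n : ℕ) (a : Fin (n + 1) → Fin (m + 4)) : Fin (m + 4) :=
  open Classical in
  if a 0 = 0 ∧ ∃ j : Fin n, ∀ i, i ≠ j → a i.succ = 1 then 1
  else if a 0 = 0 ∧ ∀ i : Fin n, a i.succ = 2 then 2
  else if 3 ≤ (a 0).val ∧ (a 0).val ≤ q + 3 ∧ ∀ i : Fin n, a i.succ = a 0 then a 0
  else 0

theorem fin_facts (m : ℕ) : ((0 : Fin (m + 4)).val = 0) ∧ ((1 : Fin (m + 4)).val = 1) ∧
    ((2 : Fin (m + 4)).val = 2) ∧ ((3 : Fin (m + 4)).val = 3) := by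
  exact ⟨rfl, Nat.mod_eq_of_lt (show 1 < m + 4 by omega),
    Nat.mod_eq_of_lt (show 2 < m + 4 by omega), Nat.mod_eq_of_lt (show 3 < m + 4 by omega)⟩

theorem chain_one {m q n : ℕ} {a : Fin (n + 1) → Fin (m + 4)} (h : chainOp m q n a = 1) :
    ∃ j : Fin n, ∀ i, i ≠ j → a i.succ = 1 := by
  obtain ⟨e0, e1, e2, e3⟩ := fin_facts m
  unfold chainOp at h
  split_ifs at h with h1 h2 h3
  · exact h1.2
  · (have hval := congrArg Fin.val h; omega)
  · rw [h, e1] at h3; omega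
  · (have hval := congrArg Fin.val h; omega)

theorem chain_two {m q n : ℕ} {a : Fin (n + 1) → Fin (m + 4)} (h : chainOp m q n a = 2) :
    ∀ i : Fin n, a i.succ = 2 := by
  obtain ⟨e0, e1, e2, e3⟩ := fin_facts m
  unfold chainOp at h
  split_ifs at h with h1 h2 h3
  · (have hval := congrArg Fin.val h; omega)
  · exact h2.2
  · rw [h, e2] at h3; omega
  · (have hval := congrArg Fin.val h; omega)

theorem chain_big {m q n : ℕ} {a : Fin (n + 1) → Fin (m + 4)} {c : Fin (m + 4)}
    (hc : 3 ≤ c.val) (h : chainOp m q n a = c) :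
    ∀ i : Fin n, a i.succ = c := by
  obtain ⟨e0, e1, e2, e3⟩ := fin_facts m
  unfold chainOp at h
  split_ifs at h with h1 h2 h3
  · rw [← h, e1] at hc; omega
  · rw [← h, e2] at hc; omega
  · rw [← h]; exact h3.2.2
  · rw [← h, e0] at hc; omega

/-- Test points. -/
def pt (m n : ℕ) (c : Fin (m + 4)) : Fin (n + 1) → Fin (m + 4) :=
  Fin.cons (if c.val ≤ 2 then 0 else c) (fun _ => c)

theorem chain_pt {m q n : ℕ} (hn : 2 ≤ n) {c : Fin (m + 4)} (h1 : 1 ≤ c.val)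
    (h2 : c.val ≤ q + 3) : chainOp m q n (pt m n c) = c := by
  obtain ⟨e0, e1, e2, e3⟩ := fin_facts m
  have hne : ∀ j : Fin n, ∃ i, i ≠ j := fun j => by
    have : Nontrivial (Fin n) := Fin.nontrivial_iff_two_le.2 hn
    exact exists_ne j
  unfold chainOp pt
  simp only [Fin.cons_zero, Fin.cons_succ]
  by_cases hc1 : c = 1
  · subst hc1
    rw [if_pos]
    refine ⟨by simp [e1], ⟨0, by omega⟩, fun _ _ => rfl⟩
  have hv1 : c.val ≠ 1 := fun h => hc1 (Fin.ext (by rw [h, e1]))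
  rw [if_neg]
  swap
  · rintro ⟨_, j, hj⟩
    obtain ⟨i, hi⟩ := hne j
    exact hc1 (hj i hi)
  by_cases hc2 : c = 2
  · subst hc2
    rw [if_pos]
    exact ⟨if_pos (by omega), fun _ => rfl⟩
  have hv2 : c.val ≠ 2 := fun h => hc2 (Fin.ext (by rw [h, e2]))
  have hv : ¬ c.val ≤ 2 := by omega
  rw [if_neg (fun h => hc2 (h.2 ⟨0, by omega⟩)), if_neg hv, if_pos]
  exact ⟨by omega, h2, fun _ => rfl⟩

theorem eq_of_agree_ess {A : Type*} {n : ℕ} (f : (Fin n → A) → A) (a b : Fin n → A)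
    (h : ∀ i ∈ essSet f, a i = b i) : f a = f b := by
  classical
  have key : ∀ s : Finset (Fin n), f (fun i => if i ∈ s then b i else a i) = f a := by
    intro s
    induction s using Finset.induction_on with
    | empty => simp
    | insert j s hj ih =>
      rw [← ih]
      by_cases hje : j ∈ essSet f
      · congr 1
        funext i
        by_cases hij : i = j
        · subst hij; simp [h i hje]
        · simp [hij]
      · by_contra hne
        refine hje ⟨_, _, ?_, hne⟩
        intro i hij
        simp [hij]
  have := key Finset.univ
  simpa using this.symm

theorem chain_sub {m q n N : ℕ} (hq : q ≤ m) (hn : 2 ≤ n) (hN : n ≤ N) :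
    Subfn (B (Fin (m + 4)) (q + 2)) ⟨N + 1, chainOp m q N⟩ ⟨n + 1, chainOp m q n⟩ := by
  obtain ⟨e0, e1, e2, e3⟩ := fin_facts m
  have hne : ∀ j : Fin n, ∃ i, i ≠ j := fun j => by
    have : Nontrivial (Fin n) := Fin.nontrivial_iff_two_le.2 hn
    exact exists_ne j
  have hz : ∃ i : Fin n, True := ⟨⟨0, by omega⟩, trivial⟩
  obtain ⟨z, -⟩ := hz
  have ex : ∀ a : Fin (N + 1) → Fin (m + 4), ∃ v : Fin (m + 4),
      (v.val = 0 ∨ (3 ≤ v.val ∧ v.val ≤ q + 3)) ∧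
      chainOp m q n (Fin.cons v (fun i : Fin n => a (Fin.castLE hN i).succ)) =
        chainOp m q N a := by
    intro a
    unfold chainOp
    simp only [Fin.cons_zero, Fin.cons_succ]
    split_ifs with h1 h2 h3
    · refine ⟨0, Or.inl rfl, ?_⟩
      obtain ⟨-, j, hj⟩ := h1
      rw [if_pos]
      refine ⟨rfl, ?_⟩
      by_cases hjn : j.val < n
      · exact ⟨⟨j.val, hjn⟩, fun i hi => hj _ (fun h => hi (Fin.ext (by simp [← h])))⟩
      · exact ⟨z, fun i _ => hj _ (fun h => hjn (by simp [← h]))⟩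
    · refine ⟨0, Or.inl rfl, ?_⟩
      rw [if_neg, if_pos]
      · exact ⟨rfl, fun i => h2.2 _⟩
      · rintro ⟨_, j, hj⟩
        obtain ⟨i, hi⟩ := hne j
        have := hj i hi
        rw [h2.2] at this
        (have hval := congrArg Fin.val this; omega)
    · have h0 : a 0 ≠ 0 := fun h => by rw [h, e0] at h3; omega
      refine ⟨a 0, Or.inr ⟨h3.1, h3.2.1⟩, ?_⟩
      rw [if_neg (fun h => h0 h.1), if_neg (fun h => h0 h.1), if_pos]
      exact ⟨h3.1, h3.2.1, fun i => h3.2.2 _⟩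
    · by_cases h4 : a (Fin.castLE hN z).succ = 3 ∧ ∀ i : Fin n, a (Fin.castLE hN i).succ = 3
      · refine ⟨0, Or.inl rfl, ?_⟩
        rw [if_neg, if_neg, if_neg]
        · rintro ⟨h, _⟩; rw [e0] at h; omega
        · rintro ⟨_, h⟩
          have := h z
          rw [h4.1] at this
          (have hval := congrArg Fin.val this; omega)
        · rintro ⟨_, j, hj⟩
          obtain ⟨i, hi⟩ := hne j
          have := hj i hi
          rw [h4.2] at this
          (have hval := congrArg Fin.val this; omega)
      · have h30 : (3 : Fin (m + 4)) ≠ 0 := fun h => by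
          have hval := congrArg Fin.val h; omega
        refine ⟨3, Or.inr ⟨by omega, by omega⟩, ?_⟩
        rw [if_neg (fun h => h30 h.1), if_neg (fun h => h30 h.1), if_neg]
        rintro ⟨_, _, h⟩
        exact h4 ⟨h z, h⟩
  choose v hv1 hv2 using ex
  refine ⟨fun i a => (Fin.cons (v a) (fun i : Fin n => a (Fin.castLE hN i).succ) :
    Fin (n + 1) → Fin (m + 4)) i, ?_, fun a => (hv2 a).symm⟩
  intro i
  refine Fin.cases ?_ (fun i => ?_) i
  · right
    simp only [rng, Fin.cons_zero]
    have hsub : Fin.val '' (Set.range v) ⊆ ((insert 0 (Finset.Icc 3 (q + 3)) : Finset ℕ) : Set ℕ) := by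
      rintro _ ⟨_, ⟨a, rfl⟩, rfl⟩
      have := hv1 a
      simpa using this
    rw [← Set.ncard_image_of_injective _ Fin.val_injective]
    refine (Set.ncard_le_ncard hsub (Finset.finite_toSet _)).trans ?_
    rw [Set.ncard_coe_finset]
    refine (Finset.card_insert_le _ _).trans ?_
    simp
  · left
    simp only [Fin.cons_succ]
    have : ∀ x, x ∈ essSet (fun a : Fin (N + 1) → Fin (m + 4) => a (Fin.castLE hN i).succ) →
        x = (Fin.castLE hN i).succ := by
      rintro x ⟨a, b, hab, hne⟩
      by_contra hx
      exact hne (hab _ (Ne.symm hx))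
    intro x hx y hy
    rw [this x hx, this y hy]

theorem chain_not_sub {m q n N : ℕ} (hq : q ≤ m) (hn : 2 ≤ n) (hN : n + 2 ≤ N) :
    ¬ Subfn (B (Fin (m + 4)) (q + 2)) ⟨n + 1, chainOp m q n⟩ ⟨N + 1, chainOp m q N⟩ := by
  obtain ⟨e0, e1, e2, e3⟩ := fin_facts m
  rintro ⟨h, hB, hf⟩
  simp only at h hB hf
  have hp : ∀ c : Fin (m + 4), 1 ≤ c.val → c.val ≤ q + 3 →
      chainOp m q N (fun i => h i (pt m n c)) = c := fun c h1 h2 => by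
    rw [← hf, chain_pt hn h1 h2]
  obtain ⟨j, hj⟩ := chain_one (hp 1 (by omega) (by omega))
  have hall : ∀ i : Fin N, i ≠ j → ∀ c : Fin (m + 4), 1 ≤ c.val → c.val ≤ q + 3 →
      h i.succ (pt m n c) = c := by
    intro i hi c h1 h2
    by_cases hc1 : c = 1
    · subst hc1; exact hj i hi
    by_cases hc2 : c = 2
    · subst hc2; exact chain_two (hp 2 h1 h2) i
    have hv1 : c.val ≠ 1 := fun h => hc1 (Fin.ext (by rw [h, e1]))
    have hv2 : c.val ≠ 2 := fun h => hc2 (Fin.ext (by rw [h, e2]))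
    exact chain_big (by omega) (hp c h1 h2) i
  have hun : ∀ i : {i : Fin N // i ≠ j}, ∃ s : Fin n, ∀ a b : Fin (n + 1) → Fin (m + 4),
      a s.succ = b s.succ → h i.1.succ a = h i.1.succ b := by
    rintro ⟨i, hi⟩
    have hE : (essSet (h i.succ)).Subsingleton := by
      rcases hB i.succ with hE | hR
      · exact hE
      · exfalso
        have hsub : ((Finset.Icc 1 (q + 3) : Finset ℕ) : Set ℕ) ⊆
            Fin.val '' (Set.range (h i.succ)) := by
          intro c hc
          simp only [Finset.coe_Icc, Set.mem_Icc] at hc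
          have hcm : c < m + 4 := by omega
          exact ⟨⟨c, hcm⟩, ⟨_, hall i hi ⟨c, hcm⟩ hc.1 hc.2⟩, rfl⟩
        have h1 := Set.ncard_le_ncard hsub (Set.toFinite _)
        rw [Set.ncard_image_of_injective _ Fin.val_injective, Set.ncard_coe_finset] at h1
        simp only [rng] at hR
        simp at h1
        omega
    have hdiff : h i.succ (pt m n 1) ≠ h i.succ (pt m n 2) := by
      rw [hall i hi 1 (by omega) (by omega), hall i hi 2 (by omega) (by omega)]
      intro h; have hval := congrArg Fin.val h; omega
    have hex : ∃ s ∈ essSet (h i.succ), pt m n 1 s ≠ pt m n 2 s := by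
      by_contra hcon
      push Not at hcon
      exact hdiff (eq_of_agree_ess _ _ _ hcon)
    obtain ⟨s, hs, hsne⟩ := hex
    have hs0 : s ≠ 0 := by
      rintro rfl
      apply hsne
      simp only [pt, Fin.cons_zero, e1, e2]
      simp
    obtain ⟨t, rfl⟩ := Fin.exists_succ_eq.2 hs0
    refine ⟨t, fun a b hab => eq_of_agree_ess _ _ _ ?_⟩
    intro x hx
    rw [hE hx hs]; exact hab
  choose σ hσ using hun
  obtain ⟨i1, i2, hne, heq⟩ : ∃ i1 i2, i1 ≠ i2 ∧ σ i1 = σ i2 := by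
    apply Fintype.exists_ne_map_eq_of_card_lt
    rw [Fintype.card_subtype_compl, Fintype.card_subtype_eq]
    simp only [Fintype.card_fin]
    omega
  let a : Fin (n + 1) → Fin (m + 4) :=
    Fin.cons 0 (Function.update (fun _ => 1) (σ i1) 2)
  have ha : chainOp m q n a = 1 := by
    unfold chainOp
    rw [if_pos]
    exact ⟨rfl, σ i1, fun i hi => by simp [a, hi]⟩
  rw [hf] at ha
  obtain ⟨j', hj'⟩ := chain_one ha
  have hbad : ∀ i : {i : Fin N // i ≠ j}, σ i = σ i1 → i.1 = j' := by
    intro i hi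
    by_contra hij
    have h1 := hj' i.1 hij
    have h2 : h i.1.succ a = h i.1.succ (pt m n 2) := by
      apply hσ i
      simp [a, hi, pt]
    rw [h2, hall i.1 i.2 2 (by omega) (by omega)] at h1
    (have hval := congrArg Fin.val h1; omega)
  exact hne (Subtype.ext ((hbad i1 rfl).trans (hbad i2 heq.symm).symm))

/-- For `k ≥ 4` and `2 ≤ p ≤ k - 2`, there is an infinite descending chain of
`B_p`-subfunctions. -/
theorem infinite_descending_chain_Bp (k : ℕ) (hk : 4 ≤ k) (p : ℕ)
    (hp2 : 2 ≤ p) (hpk : p ≤ k - 2) :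
    ∃ f : ℕ → Op (Fin k), ∀ n : ℕ, ProperSubfn (B (Fin k) p) (f (n + 1)) (f n) := by
  obtain ⟨m, rfl⟩ : ∃ m, k = m + 4 := ⟨k - 4, by omega⟩
  obtain ⟨q, rfl⟩ : ∃ q, p = q + 2 := ⟨p - 2, by omega⟩
  have hq : q ≤ m := by omega
  exact ⟨fun n => ⟨(2 * n + 2) + 1, chainOp m q (2 * n + 2)⟩, fun n =>
    ⟨chain_sub hq (by omega) (by omega), chain_not_sub hq (by omega) (by omega)⟩⟩

end PaperSubfn
end

section
/- Let C be a clone on a nonempty set A and let f = s(φ₁,…,φ_d) be a minimal C-decomposition of f. Then for every m ≥ 1 and every m-element subset S ⊆ {1,…,d}, the union ⋃_{i∈S} Ess φ_i of the sets of essential variables of the φ_i with i ∈ S has at least m elements. -/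
namespace PaperSubfn

variable {A : Type*}

/-- `(g, φ₁, …, φ_d)` is a `C`-decomposition of `f`: `f = g(φ₁, …, φ_d)` with all
`φ_i ∈ C`. -/
def IsDecomp (C : Set (Op A)) (f : Op A) (d : ℕ)
    (g : (Fin d → A) → A) (φ : Fin d → (Fin f.1 → A) → A) : Prop :=
  (∀ i, (⟨f.1, φ i⟩ : Op A) ∈ C) ∧ ∀ a, f.2 a = g fun i => φ i a

/-- `f` is a constant operation. -/
def IsConstOp (f : Op A) : Prop := ∃ c : A, ∀ a, f.2 a = c

open Classical in
/-- The `C`-degree of `f`: the least number of inner functions over all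
`C`-decompositions of `f` (and `0` for constant operations). -/
noncomputable def degC (C : Set (Op A)) (f : Op A) : ℕ :=
  if IsConstOp f then 0
  else sInf {d : ℕ | ∃ g φ, IsDecomp C f d g φ}

/-- A minimal `C`-decomposition: one with the least possible number of inner
functions. -/
def IsMinDecomp (C : Set (Op A)) (f : Op A) (d : ℕ)
    (g : (Fin d → A) → A) (φ : Fin d → (Fin f.1 → A) → A) : Prop :=
  IsDecomp C f d g φ ∧
  ∀ (d' : ℕ) (g' : (Fin d' → A) → A) (φ' : Fin d' → (Fin f.1 → A) → A),
    IsDecomp C f d' g' φ' → d ≤ d'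

/-- The range of the tuple-valued map `(φ₁, …, φ_d) : Aⁿ → A^d`. -/
def tupleRange {n d : ℕ} (φ : Fin d → (Fin n → A) → A) : Set (Fin d → A) :=
  Set.range fun a : Fin n → A => fun i => φ i a

/-- The `C`-range degree of `f`: the least cardinality of the range of the inner
functions over all minimal `C`-decompositions of `f`. -/
noncomputable def degrC (C : Set (Op A)) (f : Op A) : ℕ :=
  sInf {r : ℕ | ∃ (d : ℕ) (g : (Fin d → A) → A) (φ : Fin d → (Fin f.1 → A) → A),
    IsMinDecomp C f d g φ ∧ (tupleRange φ).ncard = r}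

/-- A tuple `(φ₁, …, φ_d)` (`d ≥ 2`) is functionally dependent if some `φ_i` is a
function of the remaining ones. -/
def FunDep {n d : ℕ} (φ : Fin d → (Fin n → A) → A) : Prop :=
  2 ≤ d ∧ ∃ (i : Fin d) (h : ({j : Fin d // j ≠ i} → A) → A),
    ∀ a, φ i a = h fun j => φ j.1 a

theorem eq_of_agree {A : Type*} {n : ℕ} (f : (Fin n → A) → A) (T : Finset (Fin n)) :
    ∀ (a b : Fin n → A), (∀ j ∈ T, j ∉ essSet f) → (∀ j, j ∉ T → a j = b j) → f a = f b := by
  induction T using Finset.induction_on with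
  | empty =>
    intro a b _ h
    have : a = b := funext fun j => h j (by simp)
    rw [this]
  | insert i T hi ih =>
    intro a b h1 h2
    have e1 : f a = f (Function.update a i (b i)) := by
      by_contra hne
      apply h1 i (by simp)
      exact ⟨a, Function.update a i (b i), fun j hj => by simp [hj], hne⟩
    rw [e1]
    apply ih _ _ (fun j hj => h1 j (by simp [hj]))
    intro j hj
    by_cases hji : j = i
    · subst hji; simp
    · simp [hji]
      exact h2 j (by simp [hji, hj])

/-- In a minimal `C`-decomposition `f = s(φ₁, …, φ_d)`, any `m` of the inner
functions depend, in total, on at least `m` essential variables. -/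
theorem minDecomp_essVars (A : Type*) [Nonempty A] (C : Set (Op A))
    (hC : IsClone C) (f : Op A) (d : ℕ)
    (s : (Fin d → A) → A) (φ : Fin d → (Fin f.1 → A) → A)
    (hmin : IsMinDecomp C f d s φ) :
    ∀ m : ℕ, 1 ≤ m → ∀ S : Finset (Fin d), S.card = m →
      m ≤ (⋃ i ∈ S, essSet (φ i)).ncard := by
  classical
  intro m _ S hS
  set E : Set (Fin f.1) := ⋃ i ∈ S, essSet (φ i) with hE
  obtain ⟨⟨hφ, hf⟩, hm⟩ := hmin
  obtain ⟨a0⟩ := ‹Nonempty A›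
  let ι := {i : Fin d // i ∉ S} ⊕ {j : Fin f.1 // j ∈ E}
  let e : ι ≃ Fin (Fintype.card ι) := Fintype.equivFin ι
  let ψ : ι → (Fin f.1 → A) → A := Sum.elim (fun i => φ i.1) (fun j a => a j.1)
  have hd := hm (Fintype.card ι)
    (fun x => s fun i => if h : i ∈ S then
        φ i (fun j => if hj : j ∈ E then x (e (Sum.inr ⟨j, hj⟩)) else a0)
      else x (e (Sum.inl ⟨i, h⟩)))
    (fun k => ψ (e.symm k)) ?_
  · have hc : Fintype.card ι = (d - m) + E.ncard := by
      have h1 : Fintype.card {i : Fin d // i ∉ S} = d - m := by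
        rw [Fintype.card_subtype_compl]; simp [hS]
      have h2 : Fintype.card {j : Fin f.1 // j ∈ E} = E.ncard := by
        rw [← Nat.card_eq_fintype_card]; rfl
      simp only [ι]
      rw [Fintype.card_sum, h1, h2]
    have hle : S.card ≤ d := by simpa using S.card_le_univ
    omega
  · refine ⟨fun k => ?_, fun a => ?_⟩
    · show (⟨f.1, ψ (e.symm k)⟩ : Op A) ∈ C
      rcases e.symm k with i | j
      · exact hφ i.1
      · exact hC.1 f.1 j.1
    · rw [hf a]
      congr 1
      funext i
      by_cases h : i ∈ S
      · simp only [h, dif_pos]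
        apply eq_of_agree (φ i) (Finset.univ.filter fun j => j ∉ E)
        · intro j hj hj'
          simp only [Finset.mem_filter, Finset.mem_univ, true_and] at hj
          exact hj (Set.mem_biUnion (x := i) h hj')
        · intro j hj
          have hj : j ∈ E := by simpa using hj
          simp [hj, ψ]
      · simp [h, ψ]

end PaperSubfn
end
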